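/- arXiv:1808.07351 — 4 statements merged into one kernel-verified Lean document; each statement's English description precedes it below -/
import Mathlib

section
/- Fix ε > 0 and let k = k(D) satisfy k ≤ (1−ε)·e·D, where e is Euler's constant. Assign to the edges of the rooted D-ary tree T_D^k a uniformly random bijective labeling f : E(T_D^k) → {1,…,e(T_D^k)}. Then with high probability (as D → ∞) there exists a path from the root to some leaf along which the labels of consecutive edges form an increasing sequence. -/
open MeasureTheory Filter Topology
open scoped ENNReal

/-- The edge set of the rooted `D`-ary tree `T_D^k` with `k` levels: an edge is identified
with its endpoint farther from the root, i.e. with a vertex at some level `i+1`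
(`0 ≤ i < k`), which is a sequence of `i+1` child-choices in `Fin D`. -/
abbrev TreeEdge (D k : ℕ) : Type := (i : Fin k) × (Fin (i.1 + 1) → Fin D)

/-- A leaf of `T_D^k` is a sequence `x : Fin k → Fin D` of child-choices; `edgeOfLeaf D k x i`
is the `i`-th edge (counted from the root) on the unique path from the root to the leaf `x`. -/
def edgeOfLeaf (D k : ℕ) (x : Fin k → Fin D) (i : Fin k) : TreeEdge D k :=
  ⟨i, fun t => x ⟨t.1, lt_of_lt_of_le t.isLt i.isLt⟩⟩

/-- Some ordering of a finite type refines the preorder induced by a given labelling. -/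
theorem exists_equivFin_lt_of_lt {E α : Type*} [Fintype E] [LinearOrder α] (u : E → α) :
    ∃ r : E ≃ Fin (Fintype.card E), ∀ a b, u a < u b → r a < r b := by
  let e := Fintype.equivFin E
  let σ := Tuple.sort (u ∘ e.symm)
  refine ⟨e.trans σ.symm, fun a b hab => ?_⟩
  by_contra! hle
  have h := Tuple.monotone_sort (u ∘ e.symm) hle
  have key : ∀ c, e.symm (σ ((e.trans σ.symm) c)) = c := fun c => by simp
  simp only [Function.comp_apply] at h
  change u (e.symm (σ ((e.trans σ.symm) b))) ≤ u (e.symm (σ ((e.trans σ.symm) a))) at h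
  rw [key, key] at h
  exact absurd hab (not_lt.mpr h)

/-- If a property of labellings with values in a linear order passes to every bijective
labelling refining it, then it is at least as likely for a uniform bijective labelling as for
a uniform labelling with values in `α`. -/
theorem card_mul_card_le_of_refine {E α : Type*} [Fintype E] [Fintype α] [LinearOrder α]
    (P : (E → α) → Prop) (Q : (E ≃ Fin (Fintype.card E)) → Prop)
    (h : ∀ (u : E → α) (f : E ≃ Fin (Fintype.card E)),
      (∀ a b, u a < u b → f a < f b) → P u → Q f) :
    Nat.card {u // P u} * Nat.card (E ≃ Fin (Fintype.card E)) ≤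
      Nat.card {f // Q f} * Nat.card (E → α) := by
  classical
  let e₀ := Fintype.equivFin E
  choose r hr using fun u : E → α => exists_equivFin_lt_of_lt u
  let φ : {u // P u} × (E ≃ Fin (Fintype.card E)) → {f // Q f} × (E → α) := fun z =>
    let u : E → α := z.1.1 ∘ (z.2.trans e₀.symm).symm
    ⟨⟨(z.2.trans e₀.symm).trans (r u), h z.1.1 _ (fun a b hab => by
      refine hr u _ _ ?_
      simpa [u] using hab) z.1.2⟩, u⟩
  have hφ : Function.Injective φ := by
    rintro ⟨⟨u, hu⟩, f⟩ ⟨⟨v, hv⟩, g⟩ heq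
    have h2 := congrArg Prod.snd heq
    have h1 := congrArg (fun z => (z.1.1 : E ≃ Fin (Fintype.card E))) heq
    simp only [φ] at h1 h2
    rw [h2] at h1
    have hfg : f = g := by
      refine Equiv.ext fun x => ?_
      have := DFunLike.congr_fun h1 x
      simpa using this
    subst hfg
    have : u = v := by
      funext x
      have := congrFun h2 (e₀.symm (f x))
      simpa using this
    subst this
    rfl
  have := Nat.card_le_card_of_injective φ hφ
  simpa only [Nat.card_prod] using this

/-- The edges of the tree with `k + 1` levels: below each child of the root there are the edge
joining it to the root and the edges of a copy of the tree with `k` levels. -/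
def TreeEdge.cons {D k : ℕ} : Fin D × Option (TreeEdge D k) → TreeEdge D (k + 1)
  | (c, none) => ⟨0, fun _ => c⟩
  | (c, some e) => ⟨e.1.succ, Fin.cons (α := fun _ => Fin D) c e.2⟩

theorem TreeEdge.cons_bijective (D k : ℕ) :
    Function.Bijective (TreeEdge.cons : Fin D × Option (TreeEdge D k) → TreeEdge D (k + 1)) := by
  constructor
  · rintro ⟨c, _ | ⟨i, y⟩⟩ ⟨d, _ | ⟨j, z⟩⟩ h
    · simp only [TreeEdge.cons, Sigma.mk.injEq, heq_eq_eq, true_and] at h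
      rw [congrFun h 0]
    · simp only [TreeEdge.cons, Sigma.mk.injEq] at h
      exact absurd h.1.symm (Fin.succ_ne_zero j)
    · simp only [TreeEdge.cons, Sigma.mk.injEq] at h
      exact absurd h.1 (Fin.succ_ne_zero i)
    · simp only [TreeEdge.cons, Sigma.mk.injEq] at h
      obtain ⟨h1, h2⟩ := h
      obtain rfl := Fin.succ_injective _ h1
      have h3 := eq_of_heq h2
      obtain ⟨rfl, rfl⟩ := Fin.cons_inj.mp h3
      rfl
  · rintro ⟨i, y⟩
    induction i using Fin.cases with
    | zero =>
      refine ⟨(y 0, none), ?_⟩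
      simp only [TreeEdge.cons, Sigma.mk.injEq, heq_eq_eq, true_and]
      funext t
      rw [Fin.fin_one_eq_zero t]
      rfl
    | succ i =>
      refine ⟨(y 0, some ⟨i, Fin.tail y⟩), ?_⟩
      simp only [TreeEdge.cons, Sigma.mk.injEq, heq_eq_eq, true_and]
      exact Fin.cons_self_tail y

theorem edgeOfLeaf_cons_zero {D k : ℕ} (c : Fin D) (x : Fin k → Fin D) :
    edgeOfLeaf D (k + 1) (Fin.cons (α := fun _ => Fin D) c x) 0 = TreeEdge.cons (c, none) := by
  simp only [edgeOfLeaf, TreeEdge.cons, Sigma.mk.injEq, heq_eq_eq, true_and]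
  funext t
  obtain rfl := Fin.fin_one_eq_zero t
  rfl

theorem edgeOfLeaf_cons_succ {D k : ℕ} (c : Fin D) (x : Fin k → Fin D) (i : Fin k) :
    edgeOfLeaf D (k + 1) (Fin.cons (α := fun _ => Fin D) c x) i.succ =
      TreeEdge.cons (c, some (edgeOfLeaf D k x i)) := by
  simp only [edgeOfLeaf, TreeEdge.cons, Sigma.mk.injEq, heq_eq_eq, true_and]
  funext t
  induction t using Fin.cases <;> rfl

/-- The labels along some root-to-leaf path decrease and are all less than `t`. -/
def HasDecreasingPath {D M k : ℕ} (t : ℕ) (u : TreeEdge D k → Fin M) : Prop :=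
  ∃ x : Fin k → Fin D, (StrictAnti fun i => u (edgeOfLeaf D k x i)) ∧
    ∀ i, (u (edgeOfLeaf D k x i)).val < t

theorem hasDecreasingPath_succ {D M k : ℕ} (t : ℕ) (u : TreeEdge D (k + 1) → Fin M) :
    HasDecreasingPath t u ↔ ∃ c : Fin D, (u (TreeEdge.cons (c, none))).val < t ∧
      HasDecreasingPath (u (TreeEdge.cons (c, none))).val
        (fun e => u (TreeEdge.cons (c, some e))) := by
  constructor
  · rintro ⟨x, hx, ht⟩
    obtain ⟨c, y, rfl⟩ : ∃ (c : Fin D) (y : Fin k → Fin D),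
        x = Fin.cons (α := fun _ => Fin D) c y := ⟨x 0, Fin.tail x, (Fin.cons_self_tail x).symm⟩
    refine ⟨c, ?_, y, fun i j hij => ?_, fun i => ?_⟩
    · simpa only [edgeOfLeaf_cons_zero] using ht 0
    · simpa only [edgeOfLeaf_cons_succ] using hx (Fin.succ_lt_succ_iff.mpr hij)
    · simpa only [edgeOfLeaf_cons_succ, edgeOfLeaf_cons_zero, Fin.lt_def]
        using hx (Fin.succ_pos i)
  · rintro ⟨c, hc, y, hy, hlt⟩
    refine ⟨Fin.cons (α := fun _ => Fin D) c y, fun i j hij => ?_, fun i => ?_⟩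
    · induction j using Fin.cases with
      | zero => exact absurd hij (Fin.not_lt_zero i)
      | succ j =>
        induction i using Fin.cases with
        | zero => simpa only [edgeOfLeaf_cons_succ, edgeOfLeaf_cons_zero, Fin.lt_def] using hlt j
        | succ i =>
          simpa only [edgeOfLeaf_cons_succ] using hy (Fin.succ_lt_succ_iff.mp hij)
    · induction i using Fin.cases with
      | zero => simpa only [edgeOfLeaf_cons_zero] using hc
      | succ i => simpa only [edgeOfLeaf_cons_succ] using (hlt i).trans hc

/-- The probability that independent uniform labels from `Fin M` on the `D`-ary tree with `k`
levels decrease along some root-to-leaf path while staying below `t`. -/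
noncomputable def decreasingPathProb (D M : ℕ) : ℕ → ℕ → ℝ
  | 0, _ => 1
  | k + 1, t => 1 - (1 - (∑ s ∈ Finset.range t, decreasingPathProb D M k s) / M) ^ D

/-- Labellings of the tree with `k + 1` levels, split over the children of the root. -/
noncomputable def treeLabellingEquiv (D k : ℕ) (α : Type) :
    (TreeEdge D (k + 1) → α) ≃ (Fin D → α × (TreeEdge D k → α)) :=
  ((Equiv.ofBijective _ (TreeEdge.cons_bijective D k)).symm.arrowCongr (Equiv.refl α)).trans
    ((Equiv.curry _ _ _).trans
      ((Equiv.refl (Fin D)).arrowCongr (Equiv.piOptionEquivProd (β := fun _ => α))))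

theorem card_add_card_not {α : Type*} [Finite α] (p : α → Prop) :
    Nat.card {a // p a} + Nat.card {a // ¬ p a} = Nat.card α := by
  classical
  rw [← Nat.card_sum]
  exact Nat.card_congr (Equiv.sumCompl p)

theorem card_hasDecreasingPath {D M : ℕ} (hM : 0 < M) (k : ℕ) {t : ℕ} (ht : t ≤ M) :
    (Nat.card {u : TreeEdge D k → Fin M // HasDecreasingPath t u} : ℝ) =
      decreasingPathProb D M k t * (Nat.card (TreeEdge D k → Fin M) : ℝ) := by
  induction k generalizing t with
  | zero =>
    have : ∀ u : TreeEdge D 0 → Fin M, HasDecreasingPath t u :=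
      fun u => ⟨Fin.elim0, fun i => i.elim0, fun i => i.elim0⟩
    rw [decreasingPathProb, one_mul, Nat.card_congr (Equiv.subtypeUnivEquiv this)]
  | succ k ih =>
    set A := Nat.card (TreeEdge D k → Fin M) with hA
    let G : Fin M × (TreeEdge D k → Fin M) → Prop :=
      fun z => z.1.val < t ∧ HasDecreasingPath z.1.val z.2
    have hG : (Nat.card {z // G z} : ℝ) =
        (∑ s ∈ Finset.range t, decreasingPathProb D M k s) * A := by
      have e : {z // G z} ≃ (v : Fin M) × {w : TreeEdge D k → Fin M // G (v, w)} :=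
        Equiv.subtypeProdEquivSigmaSubtype fun v w => G (v, w)
      rw [Nat.card_congr e, Nat.card_sigma]
      have hv : ∀ v : Fin M, (Nat.card {w : TreeEdge D k → Fin M // G (v, w)} : ℝ) =
          if v.val < t then decreasingPathProb D M k v.val * A else 0 := by
        intro v
        split_ifs with h
        · rw [← ih v.isLt.le]
          simp [G, h]
        · simp [G, h]
      push_cast
      rw [Finset.sum_congr rfl fun v _ => hv v,
        Fin.sum_univ_eq_sum_range
          (fun s => if s < t then decreasingPathProb D M k s * (A : ℝ) else 0) M,
        ← Finset.sum_filter, Finset.sum_mul]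
      congr 1
      ext s
      simp only [Finset.mem_filter, Finset.mem_range]
      omega
    have hbad : Nat.card {u : TreeEdge D (k + 1) → Fin M // ¬ HasDecreasingPath t u} =
        Nat.card {z // ¬ G z} ^ D := by
      have e : {u : TreeEdge D (k + 1) → Fin M // ¬ HasDecreasingPath t u} ≃
          {w : Fin D → Fin M × (TreeEdge D k → Fin M) // ∀ c, ¬ G (w c)} :=
        (treeLabellingEquiv D k (Fin M)).subtypeEquiv fun u => by
          rw [hasDecreasingPath_succ, not_exists]
          rfl
      rw [Nat.card_congr e, Nat.card_congr (Equiv.subtypePiEquivPi (p := fun _ z => ¬ G z)),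
        Nat.card_fun, Nat.card_fin]
    have htot : Nat.card (TreeEdge D (k + 1) → Fin M) = (M * A) ^ D := by
      rw [Nat.card_congr (treeLabellingEquiv D k (Fin M)), Nat.card_fun, Nat.card_prod,
        Nat.card_fin, Nat.card_fin]
    have h1 := card_add_card_not fun u : TreeEdge D (k + 1) → Fin M => HasDecreasingPath t u
    have h2 := card_add_card_not G
    rw [Nat.card_prod, Nat.card_fin, ← hA] at h2
    rw [hbad, htot] at h1
    have h1' := congrArg (Nat.cast (R := ℝ)) h1
    have h2' := congrArg (Nat.cast (R := ℝ)) h2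
    push_cast at h1' h2'
    have hM' : (M : ℝ) ≠ 0 := by positivity
    have h3 : (Nat.card {z // ¬ G z} : ℝ) =
        (1 - (∑ s ∈ Finset.range t, decreasingPathProb D M k s) / M) * (M * A) := by
      rw [hG] at h2'
      field_simp
      linarith
    rw [htot, decreasingPathProb]
    push_cast
    rw [h3, mul_pow] at h1'
    linarith

theorem decreasingPathProb_mem_Icc {D M : ℕ} (k : ℕ) {t : ℕ} (ht : t ≤ M) :
    decreasingPathProb D M k t ∈ Set.Icc (0 : ℝ) 1 := by
  induction k generalizing t with
  | zero => simp [decreasingPathProb]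
  | succ k ih =>
    have hmem : ∀ s ∈ Finset.range t, decreasingPathProb D M k s ∈ Set.Icc (0 : ℝ) 1 :=
      fun s hs => ih ((Finset.mem_range.mp hs).le.trans ht)
    have h0 : 0 ≤ ∑ s ∈ Finset.range t, decreasingPathProb D M k s :=
      Finset.sum_nonneg fun s hs => (hmem s hs).1
    have h1 : ∑ s ∈ Finset.range t, decreasingPathProb D M k s ≤ M := by
      calc _ ≤ ∑ s ∈ Finset.range t, (1 : ℝ) := Finset.sum_le_sum fun s hs => (hmem s hs).2
        _ = t := by simp
        _ ≤ M := by exact_mod_cast ht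
    have h2 := div_nonneg h0 (Nat.cast_nonneg (α := ℝ) M)
    have h3 := div_le_one_of_le₀ h1 (Nat.cast_nonneg (α := ℝ) M)
    rw [decreasingPathProb]
    exact ⟨sub_nonneg.mpr (pow_le_one₀ (by linarith) (by linarith)),
      sub_le_self _ (pow_nonneg (by linarith) _)⟩

theorem decreasingPathProb_succ_le_succ {D M j k s t : ℕ} (ht : t ≤ M)
    (h : ∑ i ∈ Finset.range s, decreasingPathProb D M j i ≤
      ∑ i ∈ Finset.range t, decreasingPathProb D M k i) :
    decreasingPathProb D M (j + 1) s ≤ decreasingPathProb D M (k + 1) t := by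
  have h1 : ∑ i ∈ Finset.range t, decreasingPathProb D M k i ≤ M := by
    calc _ ≤ ∑ i ∈ Finset.range t, (1 : ℝ) := Finset.sum_le_sum fun i hi =>
            (decreasingPathProb_mem_Icc k ((Finset.mem_range.mp hi).le.trans ht)).2
      _ = t := by simp
      _ ≤ M := by exact_mod_cast ht
  have h3 := div_le_one_of_le₀ h1 (Nat.cast_nonneg (α := ℝ) M)
  rw [decreasingPathProb, decreasingPathProb]
  have h4 := div_le_div_of_nonneg_right h (Nat.cast_nonneg (α := ℝ) M)
  have := pow_le_pow_left₀ (sub_nonneg.mpr h3) (sub_le_sub_left h4 1) D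
  linarith

theorem decreasingPathProb_mono {D M : ℕ} (k : ℕ) {s t : ℕ} (hst : s ≤ t) (ht : t ≤ M) :
    decreasingPathProb D M k s ≤ decreasingPathProb D M k t := by
  cases k with
  | zero => simp [decreasingPathProb]
  | succ k =>
    refine decreasingPathProb_succ_le_succ ht ?_
    refine Finset.sum_le_sum_of_subset_of_nonneg (Finset.range_mono hst) fun i hi _ => ?_
    exact (decreasingPathProb_mem_Icc k ((Finset.mem_range.mp hi).le.trans ht)).1

theorem decreasingPathProb_succ_le {D M : ℕ} (k : ℕ) {t : ℕ} (ht : t ≤ M) :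
    decreasingPathProb D M (k + 1) t ≤ decreasingPathProb D M k t := by
  induction k generalizing t with
  | zero => exact (decreasingPathProb_mem_Icc 1 ht).2
  | succ k ih =>
    exact decreasingPathProb_succ_le_succ ht
      (Finset.sum_le_sum fun i hi => ih ((Finset.mem_range.mp hi).le.trans ht))

theorem decreasingPathProb_anti {D M : ℕ} {j k : ℕ} (hjk : j ≤ k) {t : ℕ} (ht : t ≤ M) :
    decreasingPathProb D M k t ≤ decreasingPathProb D M j t := by
  induction hjk with
  | refl => rfl
  | step _ ih => exact (decreasingPathProb_succ_le _ ht).trans ih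

theorem one_sub_exp_le_decreasingPathProb {D N : ℕ} (k : ℕ) {t : ℕ}
    (ht : t ≤ D * N) {y : ℝ}
    (hy : y ≤ (∑ s ∈ Finset.range t, decreasingPathProb D (D * N) k s) / N) :
    1 - Real.exp (-y) ≤ decreasingPathProb D (D * N) (k + 1) t := by
  set S := ∑ s ∈ Finset.range t, decreasingPathProb D (D * N) k s with hS
  have h1 : S ≤ (D * N : ℕ) := by
    calc _ ≤ ∑ i ∈ Finset.range t, (1 : ℝ) := Finset.sum_le_sum fun i hi =>
            (decreasingPathProb_mem_Icc k ((Finset.mem_range.mp hi).le.trans ht)).2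
      _ = t := by simp
      _ ≤ (D * N : ℕ) := by exact_mod_cast ht
  have h2 : S / N ≤ D := by
    rcases Nat.eq_zero_or_pos N with rfl | hN
    · simp
    · rw [div_le_iff₀ (by positivity)]
      exact_mod_cast h1
  have h3 := Real.one_sub_div_pow_le_exp_neg h2
  have h4 : S / ((D * N : ℕ) : ℝ) = S / N / D := by
    rw [Nat.cast_mul, div_div, mul_comm]
  rw [decreasingPathProb, ← hS, h4]
  have h5 : Real.exp (-(S / N)) ≤ Real.exp (-y) := Real.exp_le_exp.mpr (neg_le_neg hy)
  linarith

theorem mul_le_one_sub_exp_neg {δ y : ℝ} (hy0 : 0 ≤ y) (hy : y ≤ δ) :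
    (1 - δ) * y ≤ 1 - Real.exp (-y) := by
  have h1 : Real.exp (-y) ≤ (1 + y)⁻¹ := by
    rw [Real.exp_neg]
    exact inv_anti₀ (by linarith) (by linarith [Real.add_one_le_exp y])
  have h2 : (1 + y)⁻¹ ≤ 1 - (1 - δ) * y := by
    rw [inv_le_iff_one_le_mul₀ (by linarith)]
    nlinarith [mul_nonneg hy0 (sub_nonneg.mpr hy), mul_nonneg hy0 (mul_nonneg hy0 hy0),
      mul_nonneg (mul_nonneg hy0 hy0) (hy0.trans hy)]
  linarith

theorem sum_range_choose_eq_choose_succ (u i : ℕ) :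
    ∑ s ∈ Finset.range u, s.choose i = u.choose (i + 1) := by
  induction u with
  | zero => simp
  | succ u ih => rw [Finset.sum_range_succ, ih, Nat.choose_succ_succ, add_comm]

theorem sum_range_add_ge {f g : ℕ → ℝ} {T u : ℕ} (h0 : ∀ s < T, 0 ≤ f s)
    (h : ∀ s < u, g s ≤ f (T + s)) :
    ∑ s ∈ Finset.range u, g s ≤ ∑ s ∈ Finset.range (T + u), f s := by
  rw [Finset.sum_range_add]
  have h1 : 0 ≤ ∑ s ∈ Finset.range T, f s :=
    Finset.sum_nonneg fun s hs => h0 s (Finset.mem_range.mp hs)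
  have h2 : ∑ s ∈ Finset.range u, g s ≤ ∑ s ∈ Finset.range u, f (T + s) :=
    Finset.sum_le_sum fun s hs => h s (Finset.mem_range.mp hs)
  linarith

/-- As long as the probabilities stay below `δ`, the recursion for `decreasingPathProb` loses
at most a factor `1 - δ` against its linearization, whose solution is a binomial coefficient. -/
theorem choose_mul_le_decreasingPathProb {D N : ℕ} (hN : 0 < N) {δ a : ℝ}
    (hδ0 : 0 ≤ δ) (hδ1 : δ ≤ 1) (ha : 0 ≤ a) {U : ℕ} (haU : a * 2 ^ U ≤ δ) {j T : ℕ}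
    (hj : ∀ t, T ≤ t → t ≤ D * N → a ≤ decreasingPathProb D (D * N) j t) (i : ℕ) {u : ℕ}
    (hu : u ≤ U) (hT : T + u ≤ D * N) :
    ((1 - δ) / N) ^ i * a * u.choose i ≤ decreasingPathProb D (D * N) (j + i) (T + u) := by
  have hN1 : (1 : ℝ) ≤ N := by exact_mod_cast hN
  have hr0 : 0 ≤ (1 - δ) / N := div_nonneg (by linarith) (by linarith)
  have hr1 : (1 - δ) / N ≤ 1 := div_le_one_of_le₀ (by linarith) (by linarith)
  induction i generalizing u with
  | zero => simpa using hj (T + u) (Nat.le_add_right _ _) hT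
  | succ i ih =>
    have hsum : ((1 - δ) / N) ^ i * a * u.choose (i + 1) ≤
        ∑ s ∈ Finset.range (T + u), decreasingPathProb D (D * N) (j + i) s := by
      rw [← sum_range_choose_eq_choose_succ, Nat.cast_sum, Finset.mul_sum]
      exact sum_range_add_ge (fun s hs => (decreasingPathProb_mem_Icc _ (by omega)).1)
        fun s hs => ih (by omega) (by omega)
    set y : ℝ := ((1 - δ) / N) ^ i * a * u.choose (i + 1) / N with hy
    have hy0 : 0 ≤ y := by positivity
    have hyδ : y ≤ δ := by
      have hc : (u.choose (i + 1) : ℝ) ≤ 2 ^ U := by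
        exact_mod_cast (Nat.choose_le_two_pow _ _).trans (Nat.pow_le_pow_right two_pos hu)
      calc y ≤ ((1 - δ) / N) ^ i * a * u.choose (i + 1) := div_le_self (by positivity) hN1
        _ ≤ 1 * a * 2 ^ U := by
          gcongr
          exact pow_le_one₀ hr0 hr1
        _ ≤ δ := by rwa [one_mul]
    have h1 := one_sub_exp_le_decreasingPathProb (j + i) hT
      (div_le_div_of_nonneg_right hsum (Nat.cast_nonneg (α := ℝ) N))
    have h2 := mul_le_one_sub_exp_neg hy0 hyδ
    calc ((1 - δ) / N) ^ (i + 1) * a * u.choose (i + 1) = (1 - δ) * y := by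
          rw [hy, pow_succ]; ring
      _ ≤ _ := h2.trans h1

theorem le_decreasingPathProb_mul {D N : ℕ} (hN : 0 < N) {δ a : ℝ}
    (hδ0 : 0 ≤ δ) (hδ1 : δ ≤ 1) (ha : 0 ≤ a) {U L : ℕ} (haU : a * 2 ^ U ≤ δ)
    (hUL : 1 ≤ ((1 - δ) / N) ^ L * (U.choose L : ℝ)) (m : ℕ) {t : ℕ} (hmt : m * U ≤ t)
    (ht : t ≤ D * N) : a ≤ decreasingPathProb D (D * N) (m * L) t := by
  induction m generalizing t with
  | zero =>
    have : (1 : ℝ) ≤ 2 ^ U := one_le_pow₀ one_le_two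
    rw [Nat.zero_mul, decreasingPathProb]
    nlinarith
  | succ m ih =>
    rw [Nat.succ_mul] at hmt ⊢
    have h := choose_mul_le_decreasingPathProb hN hδ0 hδ1 ha haU
      (fun t h1 h2 => ih h1 h2) L le_rfl (hmt.trans ht)
    calc a ≤ ((1 - δ) / N) ^ L * a * (U.choose L : ℝ) := by nlinarith
      _ ≤ _ := h
      _ ≤ _ := decreasingPathProb_mono _ hmt ht

theorem exists_factorial_le_mul_pow {c : ℝ} (hc : 1 < c * Real.exp 1) :
    ∃ L : ℕ, 0 < L ∧ (L.factorial : ℝ) ≤ (c * L) ^ L := by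
  have hlim := tendsto_pow_const_div_const_pow_of_one_lt 1 hc
  set K := Stirling.stirlingSeq 1 with hK
  have hK0 : 0 < K := Stirling.stirlingSeq'_pos 0
  have hev := hlim.eventually_lt_const (show (0 : ℝ) < (2 * K)⁻¹ by positivity)
  obtain ⟨L, hL, hL0⟩ := (hev.and (eventually_gt_atTop 0)).exists
  refine ⟨L, hL0, ?_⟩
  have hL1 : (1 : ℝ) ≤ L := by exact_mod_cast hL0
  have hs : Stirling.stirlingSeq L ≤ K := by
    obtain ⟨n, rfl⟩ := Nat.exists_eq_succ_of_ne_zero hL0.ne'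
    exact Stirling.stirlingSeq'_antitone (Nat.zero_le n)
  have hsq : √(2 * L : ℝ) ≤ 2 * L := by
    rw [Real.sqrt_le_left (by positivity)]
    nlinarith
  have hpow : 0 < (c * Real.exp 1) ^ L := pow_pos (by linarith) _
  rw [pow_one, div_lt_iff₀ hpow, inv_mul_eq_div, lt_div_iff₀ (by positivity)] at hL
  rw [Stirling.stirlingSeq, div_le_iff₀ (by positivity)] at hs
  calc (L.factorial : ℝ) ≤ K * (√(2 * L : ℝ) * (L / Real.exp 1) ^ L) := hs
    _ ≤ K * ((2 * L) * (L / Real.exp 1) ^ L) := by gcongr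
    _ = L * (2 * K) * (L / Real.exp 1) ^ L := by ring
    _ ≤ (c * Real.exp 1) ^ L * (L / Real.exp 1) ^ L := by gcongr
    _ = (c * L) ^ L := by
      rw [← mul_pow]
      congr 1
      field_simp

theorem exists_one_le_pow_mul_choose {τ : ℝ} (hτ : 1 < τ * Real.exp 1) :
    ∃ N L U : ℕ, 0 < N ∧ 0 < L ∧ (U : ℝ) ≤ τ * L * N ∧
      1 ≤ ((1 - 1 / (N : ℝ)) / N) ^ L * (U.choose L : ℝ) := by
  have he : 0 < Real.exp 1 := Real.exp_pos 1
  have hτ0 : 0 < τ := pos_of_mul_pos_left (one_pos.trans hτ) he.le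
  obtain ⟨N, hN⟩ := exists_nat_gt (max 1 ((1 + τ) * Real.exp 1 / (τ * Real.exp 1 - 1)))
  have hN1 : (1 : ℝ) < N := (le_max_left _ _).trans_lt hN
  have hN2 := (le_max_right _ _).trans_lt hN
  rw [div_lt_iff₀ (by linarith)] at hN2
  have hNpos : (0 : ℝ) < N := one_pos.trans hN1
  set c : ℝ := (1 - 1 / (N : ℝ)) * (τ - 1 / N) with hc
  have hce : 1 < c * Real.exp 1 := by
    have h1 : (1 + τ) * Real.exp 1 / N < τ * Real.exp 1 - 1 := by
      rw [div_lt_iff₀ hNpos]; linarith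
    have h2 : c * Real.exp 1 =
        τ * Real.exp 1 - (1 + τ) * Real.exp 1 / N + (1 / N) * (1 / N) * Real.exp 1 := by
      rw [hc]; ring
    have h3 : 0 < (1 / (N : ℝ)) * (1 / N) * Real.exp 1 := by positivity
    linarith
  have hδ : 0 < 1 - 1 / (N : ℝ) := by
    rw [sub_pos, div_lt_one hNpos]; exact hN1
  have hcpos : 0 < c := pos_of_mul_pos_left (one_pos.trans hce) he.le
  have hτN : 0 < τ - 1 / (N : ℝ) := pos_of_mul_pos_right hcpos hδ.le
  obtain ⟨L, hL0, hL⟩ := exists_factorial_le_mul_pow hce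
  refine ⟨N, L, ⌊τ * L * N⌋₊, by exact_mod_cast hNpos, hL0, Nat.floor_le (by positivity), ?_⟩
  set U := ⌊τ * L * N⌋₊ with hU
  have hUlt : τ * L * N < U + 1 := Nat.lt_floor_add_one _
  have hLfac : (0 : ℝ) < L.factorial := by exact_mod_cast L.factorial_pos
  have hLpos : (0 : ℝ) < L := by exact_mod_cast hL0
  have hsub : (τ - 1 / N) * (L * N) ≤ ((U + 1 - L : ℕ) : ℝ) := by
    have h1 : (τ - 1 / N) * (L * N) = τ * L * N - L := by
      field_simp
    have h2 : ((U + 1 : ℕ) : ℝ) - L ≤ ((U + 1 - L : ℕ) : ℝ) := by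
      rw [sub_le_iff_le_add]
      exact_mod_cast le_tsub_add
    push_cast at h2
    linarith
  have hchoose : ((τ - 1 / N) * (L * N)) ^ L / L.factorial ≤ (U.choose L : ℝ) :=
    (div_le_div_of_nonneg_right (pow_le_pow_left₀ (by positivity) hsub L) hLfac.le).trans
      (Nat.pow_le_choose L U)
  calc (1 : ℝ) ≤ (c * L) ^ L / L.factorial := (one_le_div hLfac).mpr hL
    _ = ((1 - 1 / (N : ℝ)) / N) ^ L * (((τ - 1 / N) * (L * N)) ^ L / L.factorial) := by
      rw [← mul_div_assoc, ← mul_pow, hc]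
      congr 2
      field_simp
    _ ≤ _ := by gcongr

theorem exists_one_sub_exp_le_decreasingPathProb {ε : ℝ} (hε0 : 0 < ε) (hε1 : ε < 1) :
    ∃ (N : ℕ) (α β : ℝ), 0 < N ∧ 0 < α ∧ ∀ D k : ℕ,
      (k : ℝ) ≤ (1 - ε) * Real.exp 1 * D →
      1 - Real.exp (-(α * D - β)) ≤ decreasingPathProb D (D * N) k (D * N) := by
  have he : 0 < Real.exp 1 := Real.exp_pos 1
  have hρ : 0 < (1 - ε) * Real.exp 1 := mul_pos (by linarith) he
  have hε' : 0 < 1 - ε ^ 2 := by nlinarith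
  obtain ⟨N, L, U, hN, hL, hU, hUL⟩ := exists_one_le_pow_mul_choose
    (τ := 1 / ((1 - ε ^ 2) * Real.exp 1)) (by
      rw [div_mul_eq_mul_div, one_mul, mul_comm (1 - ε ^ 2), div_mul_cancel_left₀ he.ne']
      exact (one_lt_inv₀ hε').mpr (by nlinarith))
  have hNpos : (0 : ℝ) < N := by exact_mod_cast hN
  have hLpos : (0 : ℝ) < L := by exact_mod_cast hL
  have hN1 : (1 : ℝ) ≤ N := by exact_mod_cast hN
  set δ : ℝ := 1 / N with hδ
  have hδ0 : 0 < δ := by positivity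
  have hδ1 : δ ≤ 1 := div_le_one_of_le₀ hN1 hNpos.le
  set a : ℝ := δ / 2 ^ U with ha
  have ha0 : 0 < a := by positivity
  have haU : a * 2 ^ U ≤ δ := by rw [ha, div_mul_cancel₀ _ (by positivity)]
  have hγ : U * ((1 - ε) * Real.exp 1) / (L * N) ≤ 1 / (1 + ε) := by
    rw [div_le_iff₀ (by positivity)]
    calc U * ((1 - ε) * Real.exp 1)
        ≤ (1 / ((1 - ε ^ 2) * Real.exp 1) * L * N) * ((1 - ε) * Real.exp 1) := by gcongr
      _ = 1 / (1 + ε) * (L * N) := by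
        have h1 : (1 - ε ^ 2) = (1 - ε) * (1 + ε) := by ring
        have h2 : (1 - ε) ≠ 0 := by linarith
        rw [h1]
        field_simp
  have hγ1 : 1 / (1 + ε) < 1 := (div_lt_one (by linarith)).mpr (by linarith)
  refine ⟨N, a * (1 - U * ((1 - ε) * Real.exp 1) / (L * N)), a * (U / N), hN,
    mul_pos ha0 (by linarith), fun D k hk => ?_⟩
  set m := k / L + 1 with hm
  have hkm : k ≤ m * L + 1 := by
    have := Nat.lt_div_mul_add (a := k) hL
    rw [hm, Nat.succ_mul]
    omega
  refine le_trans ?_ (decreasingPathProb_anti hkm le_rfl)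
  refine one_sub_exp_le_decreasingPathProb _ le_rfl ?_
  have hsum : a * ((D * N : ℕ) - (m * U : ℕ)) ≤
      ∑ s ∈ Finset.range (D * N), decreasingPathProb D (D * N) (m * L) s := by
    rcases le_total (m * U) (D * N) with h | h
    · obtain ⟨u, hu⟩ := Nat.exists_eq_add_of_le h
      have h1 := sum_range_add_ge (f := decreasingPathProb D (D * N) (m * L))
        (g := fun _ => a) (T := m * U) (u := u)
        (fun s hs => (decreasingPathProb_mem_Icc _ (by omega)).1)
        fun s hs => le_decreasingPathProb_mul hN hδ0.le hδ1 ha0.le haU hUL m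
          (by omega) (by omega)
      rw [← hu] at h1
      simp only [Finset.sum_const, Finset.card_range, nsmul_eq_mul] at h1
      rw [hu, Nat.cast_add, add_sub_cancel_left, mul_comm, ← hu]
      exact h1
    · have h1 : ((D * N : ℕ) : ℝ) ≤ (m * U : ℕ) := by exact_mod_cast h
      refine (mul_nonpos_of_nonneg_of_nonpos ha0.le (by linarith)).trans ?_
      exact Finset.sum_nonneg fun s hs =>
        (decreasingPathProb_mem_Icc _ (Finset.mem_range.mp hs).le).1
  refine le_trans ?_ (div_le_div_of_nonneg_right hsum hNpos.le)
  have hmr : (m : ℝ) ≤ (1 - ε) * Real.exp 1 * D / L + 1 := by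
    rw [hm, Nat.cast_add, Nat.cast_one]
    gcongr
    exact Nat.cast_div_le.trans (by gcongr)
  rw [le_div_iff₀ hNpos]
  push_cast
  calc _ = a * (D * N - ((1 - ε) * Real.exp 1 * D / L + 1) * U) := by
        field_simp
        ring
    _ ≤ _ := by gcongr

/-- fix `ε > 0` and let `k = k(D) ≤ (1−ε)·e·D`.  For a uniformly random
bijective labeling `f : E(T_D^k) ≃ {0,…,e(T_D^k)−1}` (formalized by counting: the proportion
of bijections admitting an increasing root-to-leaf path tends to `1` as `D → ∞`), whp there
is a root-to-leaf path whose consecutive edge labels increase. -/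
theorem whp_increasing_root_leaf_path
    (ε : ℝ) (hε : 0 < ε) (k : ℕ → ℕ)
    (hk : ∀ D : ℕ, (k D : ℝ) ≤ (1 - ε) * Real.exp 1 * D) :
    Tendsto (fun D : ℕ =>
      ((Nat.card {f : TreeEdge D (k D) ≃ Fin (Fintype.card (TreeEdge D (k D))) //
          ∃ x : Fin (k D) → Fin D,
            StrictMono fun i => f (edgeOfLeaf D (k D) x i)} : ℕ) : ℝ) /
      ((Nat.card (TreeEdge D (k D) ≃ Fin (Fintype.card (TreeEdge D (k D)))) : ℕ) : ℝ))
      atTop (𝓝 1) := by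
  obtain ⟨N, α, β, hN, hα, hbound⟩ := exists_one_sub_exp_le_decreasingPathProb
    (ε := min ε (1 / 2)) (lt_min hε (by norm_num))
    ((min_le_right _ _).trans_lt (by norm_num))
  have hlim : Tendsto (fun D : ℕ => 1 - Real.exp (-(α * D - β))) atTop (𝓝 1) := by
    have h1 : Tendsto (fun D : ℕ => α * (D : ℝ) - β) atTop atTop :=
      tendsto_atTop_add_const_right _ _ (tendsto_natCast_atTop_atTop.const_mul_atTop hα)
    simpa using (Real.tendsto_exp_neg_atTop_nhds_zero.comp h1).const_sub 1
  refine tendsto_of_tendsto_of_tendsto_of_le_of_le' hlim tendsto_const_nhds ?_ ?_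
  · filter_upwards [eventually_gt_atTop 0] with D hD
    have hkD : (k D : ℝ) ≤ (1 - min ε (1 / 2)) * Real.exp 1 * D :=
      (hk D).trans (by gcongr; exact min_le_left _ _)
    refine (hbound D (k D) hkD).trans ?_
    have hM : 0 < D * N := Nat.mul_pos hD hN
    have hle := card_mul_card_le_of_refine (E := TreeEdge D (k D)) (α := (Fin (D * N))ᵒᵈ)
      (fun u => HasDecreasingPath (M := D * N) (D * N) u)
      (fun f => ∃ x : Fin (k D) → Fin D, StrictMono fun i => f (edgeOfLeaf D (k D) x i))
      (fun u f hf ⟨x, hx, _⟩ => ⟨x, fun i j hij => hf _ _ (hx hij)⟩)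
    have hcard := card_hasDecreasingPath (D := D) hM (k D) le_rfl
    have hpos : (0 : ℝ) < Nat.card (TreeEdge D (k D) → Fin (D * N)) := by
      have : Nonempty (Fin (D * N)) := ⟨⟨0, hM⟩⟩
      exact_mod_cast Nat.card_pos
    have hpos' : (0 : ℝ) <
        Nat.card (TreeEdge D (k D) ≃ Fin (Fintype.card (TreeEdge D (k D)))) := by
      have : Nonempty (TreeEdge D (k D) ≃ Fin (Fintype.card (TreeEdge D (k D)))) :=
        ⟨Fintype.equivFin _⟩
      exact_mod_cast Nat.card_pos
    rw [le_div_iff₀ hpos']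
    refine le_of_mul_le_mul_right ?_ hpos
    have hle' := Nat.cast_le (α := ℝ) |>.mpr hle
    rw [Nat.cast_mul, Nat.cast_mul] at hle'
    calc _ = (decreasingPathProb D (D * N) (k D) (D * N) *
          Nat.card (TreeEdge D (k D) → Fin (D * N))) *
            Nat.card (TreeEdge D (k D) ≃ Fin (Fintype.card (TreeEdge D (k D)))) := by ring
      _ ≤ _ := by rw [← hcard]; exact hle'
  · refine Eventually.of_forall fun D => div_le_one_of_le₀ ?_ (Nat.cast_nonneg _)
    exact_mod_cast Nat.card_le_card_of_injective _ Subtype.val_injective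
end

section
/- Fix ε > 0 with ε sufficiently small. There exists a constant c > 0 (depending only on ε) such that for all D and all k with 1 ≤ k ≤ (1−ε)·e·D, if the edges of the rooted D-ary tree T_D^k are given i.i.d. labels uniform on [0,1], then the probability that there exists a root-to-leaf path whose labels are increasing and all strictly less than 1 − ε/2 is at least c / k^{3/2}. -/
open MeasureTheory Filter Topology
open scoped ENNReal

/-- The product of uniform measures on `[0,1]`, one coordinate for each element of `ι`:
i.i.d. uniform `[0,1]` random labels. -/
noncomputable def cubeMeasure (ι : Type) [Fintype ι] : Measure (ι → ℝ) :=
  Measure.pi fun _ => volume.restrict (Set.Icc (0:ℝ) 1)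

instance isProbabilityMeasure_volume_restrict_Icc :
    IsProbabilityMeasure (volume.restrict (Set.Icc (0:ℝ) 1)) := ⟨by simp⟩

instance isProbabilityMeasure_cubeMeasure (ι : Type) [Fintype ι] :
    IsProbabilityMeasure (cubeMeasure ι) := by
  unfold cubeMeasure
  infer_instance

lemma volume_restrict_unitInterval_Ioo {a b : ℝ} (ha : 0 ≤ a) (hb : b ≤ 1) :
    volume.restrict (Set.Icc (0:ℝ) 1) (Set.Ioo a b) = ENNReal.ofReal (b - a) := by
  rw [Measure.restrict_apply measurableSet_Ioo, Set.inter_eq_left.2, Real.volume_Ioo]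
  exact fun x hx => ⟨ha.trans hx.1.le, hx.2.le.trans hb⟩

/-- Reading off the labels of distinct elements gives again independent uniform labels. -/
lemma measurePreserving_cubeMeasure_comp {ι ι' : Type} [Fintype ι] [Fintype ι'] {f : ι' → ι}
    (hf : f.Injective) :
    MeasurePreserving (fun (ℓ : ι → ℝ) i => ℓ (f i)) (cubeMeasure ι) (cubeMeasure ι') := by
  refine ⟨by fun_prop, ?_⟩
  have h := ((ProbabilityTheory.iIndepFun_pi (μ := fun _ : ι => volume.restrict (Set.Icc (0:ℝ) 1))
    (X := fun _ => id) (fun _ => aemeasurable_id)).precomp hf).map_fun_eq_pi_map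
    fun i => (measurable_pi_apply (f i)).aemeasurable
  unfold cubeMeasure
  refine h.trans ?_
  congr 1
  funext i
  exact (measurePreserving_eval (fun _ : ι => volume.restrict (Set.Icc (0:ℝ) 1)) (f i)).map_eq

/-- Events about disjoint families of labels are independent. -/
lemma cubeMeasure_inter_of_disjoint {ι ι' : Type} [Fintype ι] [Fintype ι'] {f g : ι' → ι}
    (hf : f.Injective) (hg : g.Injective) {p : ι' → Prop} (hfg : ∀ a b, p b → f a ≠ g b)
    {A B : Set (ι' → ℝ)} (hA : MeasurableSet A) (hB : MeasurableSet B)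
    (hBp : ∀ u v : ι' → ℝ, (∀ b, p b → u b = v b) → u ∈ B → v ∈ B) :
    cubeMeasure ι {ℓ | (fun i => ℓ (f i)) ∈ A ∧ (fun i => ℓ (g i)) ∈ B} =
      cubeMeasure ι' A * cubeMeasure ι' B := by
  classical
  let fill : ({b // p b} → ℝ) → ι' → ℝ := fun w b => if h : p b then w ⟨b, h⟩ else 0
  have hfill : Measurable fill := by
    refine measurable_pi_lambda _ fun b => ?_
    by_cases h : p b <;> simp only [fill, h, dite_true, dite_false] <;> fun_prop
  have hmem : ∀ u : ι' → ℝ, u ∈ B ↔ (fun b : {b // p b} => u b) ∈ fill ⁻¹' B := by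
    intro u
    constructor <;> refine hBp _ _ fun b hb => ?_ <;> simp [fill, hb]
  have hB' : MeasurableSet (fill ⁻¹' B) := hfill hB
  have hBv : cubeMeasure ι' B = cubeMeasure {b // p b} (fill ⁻¹' B) := by
    rw [← (measurePreserving_cubeMeasure_comp (Subtype.val_injective (p := p))).measure_preimage
      hB'.nullMeasurableSet]
    congr 1
    ext u
    exact hmem u
  have hinj : (Sum.elim f (fun b : {b // p b} => g b)).Injective :=
    hf.sumElim (hg.comp Subtype.val_injective) fun a b => hfg a b b.2
  have hmp := (measurePreserving_sumPiEquivProdPi (X := fun _ : ι' ⊕ {b // p b} => ℝ)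
    fun _ => volume.restrict (Set.Icc (0:ℝ) 1)).comp (measurePreserving_cubeMeasure_comp hinj)
  rw [hBv]
  refine Eq.trans ?_ (Measure.prod_prod (μ := cubeMeasure ι') (ν := cubeMeasure {b // p b}) _ _)
  refine Eq.trans ?_ (hmp.measure_preimage (hA.prod hB').nullMeasurableSet)
  congr 1
  ext ℓ
  exact and_congr Iff.rfl (hmem _)

/-- Independence of the rows of an array of independent uniform labels. -/
lemma cubeMeasure_forall_row {n m : ℕ} (B : Fin n → Set (Fin m → ℝ))
    (hB : ∀ j, MeasurableSet (B j)) :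
    cubeMeasure (Fin n × Fin m) {u | ∀ j, (fun r => u (j, r)) ∈ B j} =
      ∏ j, cubeMeasure (Fin m) (B j) := by
  have h := Measure.infinitePi_map_curry (ι := Fin n) (κ := Fin m) (X := ℝ)
    (fun _ _ => volume.restrict (Set.Icc (0:ℝ) 1))
  simp only [Measure.infinitePi_eq_pi] at h
  unfold cubeMeasure
  rw [← Measure.pi_pi, ← h, Measure.map_apply (by fun_prop) (.univ_pi hB)]
  congr 1
  ext u
  simp only [Set.mem_ofPred_eq, Set.mem_preimage, Set.mem_univ_pi]
  rfl

/-- Strictly increasing sequences with values in the interval `(a, b)`. -/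
def increasingIn (m : ℕ) (a b : ℝ) : Set (Fin m → ℝ) :=
  {u | StrictMono u ∧ ∀ i, u i ∈ Set.Ioo a b}

lemma measurableSet_increasingIn (m : ℕ) (a b : ℝ) : MeasurableSet (increasingIn m a b) := by
  have : increasingIn m a b = (⋂ i, ⋂ j, ⋂ _ : i < j, {u : Fin m → ℝ | u i < u j}) ∩
      ⋂ i, {u : Fin m → ℝ | u i ∈ Set.Ioo a b} := by
    ext u
    simp [increasingIn, StrictMono]
  rw [this]
  refine .inter (.iInter fun i => .iInter fun j => .iInter fun _ => ?_) (.iInter fun i => ?_)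
  · exact measurableSet_lt (measurable_pi_apply i) (measurable_pi_apply j)
  · exact measurable_pi_apply i measurableSet_Ioo

lemma cons_mem_increasingIn {m : ℕ} {a b x : ℝ} {u : Fin m → ℝ} :
    (Fin.cons x u : Fin (m + 1) → ℝ) ∈ increasingIn (m + 1) a b ↔
      x ∈ Set.Ioo a b ∧ u ∈ increasingIn m x b := by
  simp only [increasingIn, Set.mem_ofPred_eq, Set.mem_Ioo]
  constructor
  · rintro ⟨h1, h2⟩
    refine ⟨by simpa using h2 0, fun i j hij => ?_, fun i => ⟨?_, ?_⟩⟩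
    · simpa using h1 (Fin.succ_lt_succ_iff.2 hij)
    · simpa using h1 (Fin.succ_pos i)
    · simpa using (h2 i.succ).2
  · rintro ⟨h1, h2, h3⟩
    refine ⟨fun i j hij => ?_, fun i => ?_⟩
    · induction j using Fin.cases with
      | zero => simp at hij
      | succ j =>
        induction i using Fin.cases with
        | zero => simpa using (h3 j).1
        | succ i => simpa using h2 (Fin.succ_lt_succ_iff.1 hij)
    · induction i using Fin.cases with
      | zero => simpa using h1
      | succ i => simpa using ⟨h1.1.trans (h3 i).1, (h3 i).2⟩

lemma cubeMeasure_increasingIn (m : ℕ) {a b : ℝ} (ha : 0 ≤ a) (hab : a ≤ b) (hb : b ≤ 1) :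
    cubeMeasure (Fin m) (increasingIn m a b) = ENNReal.ofReal ((b - a) ^ m / m.factorial) := by
  induction m generalizing a with
  | zero =>
    have : increasingIn 0 a b = Set.univ := by
      ext u
      simp [increasingIn, StrictMono]
    rw [this, measure_univ]
    simp
  | succ m ih =>
    have hmp := (measurePreserving_piFinSuccAbove
      (fun _ : Fin (m + 1) => volume.restrict (Set.Icc (0:ℝ) 1)) 0).symm
    change MeasurePreserving _ (Measure.prod _ (cubeMeasure (Fin m))) (cubeMeasure (Fin (m + 1)))
      at hmp
    have hmeas := measurableSet_increasingIn (m + 1) a b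
    rw [← hmp.measure_preimage hmeas.nullMeasurableSet, Measure.prod_apply (hmp.measurable hmeas)]
    have hsec : ∀ x : ℝ, cubeMeasure (Fin m) (Prod.mk x ⁻¹'
        ((MeasurableEquiv.piFinSuccAbove (fun _ => ℝ) 0).symm ⁻¹' increasingIn (m + 1) a b)) =
        (Set.Ioo a b).indicator (fun x => ENNReal.ofReal ((b - x) ^ m / m.factorial)) x := by
      intro x
      have h1 : (Prod.mk x ⁻¹'
        ((MeasurableEquiv.piFinSuccAbove (fun _ => ℝ) 0).symm ⁻¹' increasingIn (m + 1) a b)) =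
          {u | x ∈ Set.Ioo a b ∧ u ∈ increasingIn m x b} := by
        ext u
        refine Iff.trans ?_ cons_mem_increasingIn
        simp [MeasurableEquiv.piFinSuccAbove, Fin.insertNthEquiv]
      rw [h1]
      by_cases hx : x ∈ Set.Ioo a b
      · simp only [hx, true_and, Set.ofPred_mem_eq, Set.indicator_of_mem]
        exact ih (ha.trans hx.1.le) hx.2.le
      · simp [hx]
    have hsub : Set.Ioo a b ⊆ Set.Icc (0:ℝ) 1 :=
      fun x hx => ⟨ha.trans hx.1.le, hx.2.le.trans hb⟩
    simp_rw [hsec]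
    rw [lintegral_indicator measurableSet_Ioo, Measure.restrict_restrict measurableSet_Ioo,
      Set.inter_eq_left.2 hsub, ← ofReal_integral_eq_lintegral_ofReal]
    · congr 1
      rw [← integral_Ioc_eq_integral_Ioo, ← intervalIntegral.integral_of_le hab,
        intervalIntegral.integral_div,
        intervalIntegral.integral_comp_sub_left (fun x => x ^ m), integral_pow]
      rw [Nat.factorial_succ]
      push_cast
      field_simp
      simp
    · exact ((by fun_prop : Continuous fun x : ℝ => (b - x) ^ m / m.factorial).integrableOn_Icc
        (a := a) (b := b)).mono_set Set.Ioo_subset_Icc_self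
    · filter_upwards [ae_restrict_mem measurableSet_Ioo] with x hx
      have := hx.2
      have : 0 ≤ b - x := by linarith
      simp only [Pi.zero_apply]
      positivity

/-- The second moment method for a finite family of events. -/
lemma sq_sum_measureReal_le {Ω X : Type*} [MeasurableSpace Ω] [Fintype X] (μ : Measure Ω)
    [IsProbabilityMeasure μ] {A : X → Set Ω} (hA : ∀ x, MeasurableSet (A x)) :
    (∑ x, μ.real (A x)) ^ 2 ≤ (∑ x, ∑ y, μ.real (A x ∩ A y)) * μ.real (⋃ x, A x) := by
  let f : X → Ω → ℝ := fun x => (A x).indicator 1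
  let g : Ω → ℝ := (⋃ x, A x).indicator 1
  have hU : MeasurableSet (⋃ x, A x) := .iUnion hA
  have hf : ∀ x, Integrable (f x) μ := fun x => (integrable_const 1).indicator (hA x)
  have hg : Integrable g μ := (integrable_const 1).indicator hU
  have hff : ∀ x y ω, f x ω * f y ω = (A x ∩ A y).indicator 1 ω := by
    intro x y ω
    by_cases h1 : ω ∈ A x <;> by_cases h2 : ω ∈ A y <;> simp [f, h1, h2]
  have hgf : ∀ x ω, g ω * f x ω = f x ω := by
    intro x ω
    by_cases h : ω ∈ A x
    · have : ω ∈ ⋃ x, A x := Set.mem_iUnion.2 ⟨x, h⟩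
      simp only [g, Set.indicator_of_mem this, Pi.one_apply, one_mul]
    · simp [f, h]
  have hgg : ∀ ω, g ω * g ω = g ω := by
    intro ω
    by_cases h : ω ∈ ⋃ x, A x <;> simp only [g, h, Set.indicator_of_mem,
      Set.indicator_of_notMem, not_false_eq_true, Pi.one_apply, mul_one, mul_zero]
  have hfint : ∀ x, ∫ ω, f x ω ∂μ = μ.real (A x) := fun x => integral_indicator_one (hA x)
  have hgint : ∫ ω, g ω ∂μ = μ.real (⋃ x, A x) := integral_indicator_one hU
  have hffint : ∀ x y, ∫ ω, f x ω * f y ω ∂μ = μ.real (A x ∩ A y) := by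
    intro x y
    simp_rw [hff]
    exact integral_indicator_one ((hA x).inter (hA y))
  have hffi : ∀ x y, Integrable (fun ω => f x ω * f y ω) μ := by
    intro x y
    simp_rw [hff]
    exact (integrable_const 1).indicator ((hA x).inter (hA y))
  have key : ∀ t : ℝ, 0 ≤ μ.real (⋃ x, A x) * (t * t) + (-2 * ∑ x, μ.real (A x)) * t +
      ∑ x, ∑ y, μ.real (A x ∩ A y) := by
    intro t
    have h0 : 0 ≤ ∫ ω, (t * g ω - ∑ x, f x ω) ^ 2 ∂μ := integral_nonneg fun _ => sq_nonneg _
    have hexp : ∀ ω, (t * g ω - ∑ x, f x ω) ^ 2 =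
        t * t * g ω - 2 * t * ∑ x, f x ω + ∑ x, ∑ y, f x ω * f y ω := by
      intro ω
      have h1 : g ω * ∑ x, f x ω = ∑ x, f x ω := by
        rw [Finset.mul_sum]
        exact Finset.sum_congr rfl fun x _ => hgf x ω
      rw [← Finset.sum_mul_sum]
      linear_combination (t * t) * hgg ω - 2 * t * h1
    have hs1 : Integrable (fun ω => ∑ x, f x ω) μ := integrable_finsetSum _ fun x _ => hf x
    have hs2 : Integrable (fun ω => ∑ x, ∑ y, f x ω * f y ω) μ :=
      integrable_finsetSum _ fun x _ => integrable_finsetSum _ fun y _ => hffi x y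
    simp_rw [hexp] at h0
    rw [integral_add (f := fun ω => t * t * g ω - 2 * t * ∑ x, f x ω)
      ((hg.const_mul _).sub (hs1.const_mul _)) hs2,
      integral_sub (hg.const_mul _) (hs1.const_mul _), integral_const_mul, integral_const_mul,
      integral_finsetSum _ fun x _ => hf x,
      integral_finsetSum _ fun x _ => integrable_finsetSum _ fun y _ => hffi x y] at h0
    simp_rw [integral_finsetSum _ fun y _ => hffi _ y, hffint, hfint, hgint] at h0
    linarith
  have := discrim_le_zero key
  unfold discrim at this
  nlinarith

/-- Position of an edge on a path cut into `n` blocks of `m` edges. -/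
lemma finProdFinEquiv_le_of_le {n m : ℕ} {j₀ j : Fin n} {r₀ r : Fin m}
    (h : j₀ < j ∨ j₀ = j ∧ r₀ ≤ r) : finProdFinEquiv (j₀, r₀) ≤ finProdFinEquiv (j, r) := by
  rw [Fin.le_def, finProdFinEquiv_apply_val, finProdFinEquiv_apply_val]
  rcases h with h | ⟨rfl, h⟩
  · have h1 : j₀.1 + 1 ≤ j.1 := h
    have h2 := Nat.mul_le_mul_left m h1
    have := r₀.2
    simp only
    lia
  · have : r₀.1 ≤ r.1 := h
    simp only
    lia

/-- The labels along the path to the leaf `x` that lie in the `j`-th block of `m` edges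
increase inside the window `(j s, (j + 1) s)`, for each `j`. -/
def blockIncreasing (D n m : ℕ) (s : ℝ) (x : Fin (n * m) → Fin D) :
    Set (TreeEdge D (n * m) → ℝ) :=
  {ℓ | ∀ j : Fin n, (fun r => ℓ (edgeOfLeaf D (n * m) x (finProdFinEquiv (j, r)))) ∈
    increasingIn m (j * s) ((j + 1) * s)}

lemma edgeOfLeaf_injective (D k : ℕ) (x : Fin k → Fin D) :
    (edgeOfLeaf D k x).Injective := fun _ _ h => congrArg Sigma.fst h

/-- Beyond the first edge where they differ, two paths have no common edge. -/
lemma edgeOfLeaf_ne {D k : ℕ} {x y : Fin k → Fin D} {l : Fin k} (h : x l ≠ y l) (i : Fin k)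
    {i' : Fin k} (hi : l ≤ i') : edgeOfLeaf D k x i ≠ edgeOfLeaf D k y i' := by
  intro he
  obtain rfl : i = i' := congrArg Sigma.fst he
  have h2 := eq_of_heq (Sigma.mk.inj he).2
  exact h (congrFun h2 ⟨l.1, Nat.lt_succ_of_le hi⟩)

lemma window_bounds {n : ℕ} {s : ℝ} (hs : 0 ≤ s) (hns : n * s ≤ 1) (j : Fin n) :
    0 ≤ j * s ∧ j * s ≤ (j + 1) * s ∧ (j + 1) * s ≤ 1 := by
  have : ((j.1 + 1 : ℕ) : ℝ) ≤ n := Nat.cast_le.2 j.2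
  push_cast at this
  refine ⟨by positivity, by nlinarith, by nlinarith⟩

lemma cubeMeasure_window (m : ℕ) {n : ℕ} {s : ℝ} (hs : 0 ≤ s) (hns : n * s ≤ 1) (j : Fin n) :
    cubeMeasure (Fin m) (increasingIn m (j * s) ((j + 1) * s)) =
      ENNReal.ofReal (s ^ m / m.factorial) := by
  obtain ⟨h1, h2, h3⟩ := window_bounds hs hns j
  rw [cubeMeasure_increasingIn m h1 h2 h3]
  ring_nf

lemma measurableSet_forall_row {n m : ℕ} {B : Fin n → Set (Fin m → ℝ)}
    (hB : ∀ j, MeasurableSet (B j)) :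
    MeasurableSet {u : Fin n × Fin m → ℝ | ∀ j, (fun r => u (j, r)) ∈ B j} := by
  rw [Set.ofPred_forall]
  exact .iInter fun j =>
    (by fun_prop : Measurable fun (u : Fin n × Fin m → ℝ) r => u (j, r)) (hB j)

lemma measurableSet_blockIncreasing (D n m : ℕ) (s : ℝ) (x : Fin (n * m) → Fin D) :
    MeasurableSet (blockIncreasing D n m s x) :=
  (by fun_prop : Measurable fun (ℓ : TreeEdge D (n * m) → ℝ) (p : Fin n × Fin m) =>
    ℓ (edgeOfLeaf D (n * m) x (finProdFinEquiv p)))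
    (measurableSet_forall_row fun _ => measurableSet_increasingIn _ _ _)

lemma cubeMeasure_forall_window (m : ℕ) {n : ℕ} {s : ℝ} (hs : 0 ≤ s) (hns : n * s ≤ 1) :
    cubeMeasure (Fin n × Fin m)
      {u | ∀ j : Fin n, (fun r => u (j, r)) ∈ increasingIn m (j * s) ((j + 1) * s)} =
      ENNReal.ofReal ((s ^ m / m.factorial) ^ n) := by
  rw [cubeMeasure_forall_row _ fun _ => measurableSet_increasingIn _ _ _]
  simp_rw [cubeMeasure_window m hs hns]
  rw [Finset.prod_const, Finset.card_univ, Fintype.card_fin, ENNReal.ofReal_pow (by positivity)]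

lemma cubeMeasure_blockIncreasing (D m : ℕ) {n : ℕ} {s : ℝ} (hs : 0 ≤ s) (hns : n * s ≤ 1)
    (x : Fin (n * m) → Fin D) :
    cubeMeasure (TreeEdge D (n * m)) (blockIncreasing D n m s x) =
      ENNReal.ofReal ((s ^ m / m.factorial) ^ n) := by
  rw [← cubeMeasure_forall_window m hs hns]
  exact (measurePreserving_cubeMeasure_comp
    ((edgeOfLeaf_injective D _ x).comp finProdFinEquiv.injective)).measure_preimage
    (measurableSet_forall_row fun _ => measurableSet_increasingIn _ _ _).nullMeasurableSet

lemma cubeMeasure_tail_window {m n : ℕ} {s : ℝ} (hs : 0 ≤ s) (hns : n * s ≤ 1)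
    (j : Fin n) (r₀ : Fin m) :
    cubeMeasure (Fin m) {u | ∀ r, r₀ ≤ r → u r ∈ Set.Ioo (j * s) ((j + 1) * s)} =
      ENNReal.ofReal (s ^ (m - r₀)) := by
  obtain ⟨h1, h2, h3⟩ := window_bounds hs hns j
  have : {u : Fin m → ℝ | ∀ r, r₀ ≤ r → u r ∈ Set.Ioo (j * s) ((j + 1) * s)} =
      Set.univ.pi fun r => if r₀ ≤ r then Set.Ioo (j * s) ((j + 1) * s) else Set.univ := by
    ext u
    simp only [Set.mem_ofPred_eq, Set.mem_univ_pi]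
    refine forall_congr' fun r => ?_
    split_ifs with h <;> simp [h]
  rw [this, cubeMeasure, Measure.pi_pi]
  simp_rw [apply_ite (volume.restrict (Set.Icc (0:ℝ) 1)), measure_univ,
    volume_restrict_unitInterval_Ioo h1 h3]
  rw [Finset.prod_ite, Finset.prod_const_one, mul_one, Finset.prod_const,
    Finset.filter_le_eq_Ici, Fin.card_Ici, ENNReal.ofReal_pow hs]
  ring_nf

/-- Joint probability for two paths that differ at the edge `r₀` of block `j₀`. -/
lemma cubeMeasure_blockIncreasing_inter_le {D m n : ℕ} {s : ℝ} (hs : 0 ≤ s) (hns : n * s ≤ 1)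
    {x y : Fin (n * m) → Fin D} {j₀ : Fin n} {r₀ : Fin m}
    (hxy : x (finProdFinEquiv (j₀, r₀)) ≠ y (finProdFinEquiv (j₀, r₀))) :
    cubeMeasure (TreeEdge D (n * m)) (blockIncreasing D n m s x ∩ blockIncreasing D n m s y) ≤
      ENNReal.ofReal ((s ^ m / m.factorial) ^ n *
        (s ^ (m - r₀) * (s ^ m / m.factorial) ^ (n - 1 - j₀))) := by
  let W : Fin n → Set ℝ := fun j => Set.Ioo (j * s) ((j + 1) * s)
  let B : Fin n → Set (Fin m → ℝ) := fun j =>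
    if j = j₀ then {u | ∀ r, r₀ ≤ r → u r ∈ W j}
    else if j₀ < j then increasingIn m (j * s) ((j + 1) * s) else Set.univ
  have hBm : ∀ j, MeasurableSet (B j) := by
    intro j
    simp only [B]
    split_ifs
    · simp_rw [Set.ofPred_forall]
      exact .iInter fun r => .iInter fun _ => measurable_pi_apply r measurableSet_Ioo
    · exact measurableSet_increasingIn _ _ _
    · exact .univ
  have hB : cubeMeasure (Fin n × Fin m) {u | ∀ j, (fun r => u (j, r)) ∈ B j} =
      ENNReal.ofReal (s ^ (m - r₀) * (s ^ m / m.factorial) ^ (n - 1 - j₀)) := by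
    have hval : ∀ j, cubeMeasure (Fin m) (B j) =
        (if j = j₀ then ENNReal.ofReal (s ^ (m - r₀)) else 1) *
          (if j₀ < j then ENNReal.ofReal (s ^ m / m.factorial) else 1) := by
      intro j
      simp only [B]
      split_ifs with h1 h2 h2
      · exact absurd h2 (by simp [h1])
      · rw [mul_one]
        exact cubeMeasure_tail_window hs hns j r₀
      · rw [one_mul, cubeMeasure_window m hs hns]
      · rw [measure_univ, one_mul]
    rw [cubeMeasure_forall_row _ hBm, Finset.prod_congr rfl fun j _ => hval j,
      Finset.prod_mul_distrib, Finset.prod_ite_eq' Finset.univ j₀, if_pos (Finset.mem_univ _),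
      Finset.prod_ite, Finset.prod_const_one, mul_one, Finset.prod_const,
      Finset.filter_lt_eq_Ioi, Fin.card_Ioi, ENNReal.ofReal_mul (by positivity),
      ENNReal.ofReal_pow (by positivity : 0 ≤ s ^ m / m.factorial)]
  rw [ENNReal.ofReal_mul (by positivity), ← cubeMeasure_forall_window m hs hns, ← hB,
    ← cubeMeasure_inter_of_disjoint
      (f := fun p => edgeOfLeaf D (n * m) x (finProdFinEquiv p))
      (g := fun p => edgeOfLeaf D (n * m) y (finProdFinEquiv p))
      (p := fun p => finProdFinEquiv (j₀, r₀) ≤ finProdFinEquiv p)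
      ((edgeOfLeaf_injective D _ x).comp finProdFinEquiv.injective)
      ((edgeOfLeaf_injective D _ y).comp finProdFinEquiv.injective)
      (fun a b hb => edgeOfLeaf_ne hxy _ hb)
      (measurableSet_forall_row fun _ => measurableSet_increasingIn _ _ _)
      (measurableSet_forall_row hBm)]
  · refine measure_mono fun ℓ hℓ => ⟨hℓ.1, fun j => ?_⟩
    have := hℓ.2 j
    simp only [B]
    split_ifs
    · exact fun r _ => this.2 r
    · exact this
    · trivial
  · intro u v huv hu j
    have := hu j
    simp only [B] at this ⊢
    split_ifs at this ⊢ with h1 h2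
    · intro r hr
      have h3 : u (j, r) ∈ W j := this r hr
      rwa [huv _ (finProdFinEquiv_le_of_le (.inr ⟨h1.symm, hr⟩))] at h3
    · convert this using 2 with r
      exact (huv _ (finProdFinEquiv_le_of_le (.inl h2))).symm
    · trivial

lemma card_filter_agree_below {D k : ℕ} (x : Fin k → Fin D) (l : Fin k) :
    (Finset.univ.filter fun y : Fin k → Fin D => ∀ i < l, x i = y i).card = D ^ (k - l) := by
  have : (Finset.univ.filter fun y : Fin k → Fin D => ∀ i < l, x i = y i) =
      Fintype.piFinset fun i => if l ≤ i then Finset.univ else {x i} := by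
    ext y
    simp only [Finset.mem_filter, Finset.mem_univ, true_and, Fintype.mem_piFinset]
    refine forall_congr' fun i => ?_
    split_ifs with h
    · simp [not_lt.2 h]
    · simp [not_le.1 h, eq_comm]
  rw [this, Fintype.card_piFinset]
  simp_rw [apply_ite Finset.card, Finset.card_univ, Fintype.card_fin, Finset.card_singleton]
  rw [Finset.prod_ite, Finset.prod_const_one, mul_one, Finset.prod_const,
    Finset.filter_le_eq_Ici, Fin.card_Ici]

lemma measureReal_blockIncreasing_inter_le {D m n : ℕ} {s : ℝ} (hs : 0 ≤ s) (hns : n * s ≤ 1)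
    (x y : Fin (n * m) → Fin D) :
    (cubeMeasure (TreeEdge D (n * m))).real
        (blockIncreasing D n m s x ∩ blockIncreasing D n m s y) ≤
      (if x = y then (s ^ m / m.factorial) ^ n else 0) +
        ∑ p : Fin n × Fin m, if ∀ i < finProdFinEquiv p, x i = y i then
          (s ^ m / m.factorial) ^ n * (s ^ (m - p.2) * (s ^ m / m.factorial) ^ (n - 1 - p.1))
        else 0 := by
  have hnonneg : ∀ p : Fin n × Fin m, 0 ≤ if ∀ i < finProdFinEquiv p, x i = y i then
      (s ^ m / m.factorial) ^ n * (s ^ (m - p.2) * (s ^ m / m.factorial) ^ (n - 1 - p.1))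
      else (0:ℝ) := fun p => by split_ifs <;> positivity
  by_cases hxy : x = y
  · subst hxy
    rw [if_pos rfl, Set.inter_self, measureReal_def, cubeMeasure_blockIncreasing D m hs hns,
      ENNReal.toReal_ofReal (by positivity)]
    exact le_add_of_nonneg_right (Finset.sum_nonneg fun p _ => hnonneg p)
  · obtain ⟨l, hl, hmin⟩ := wellFounded_lt.has_min {l | x l ≠ y l} (Function.ne_iff.1 hxy)
    obtain ⟨⟨j, r⟩, rfl⟩ := finProdFinEquiv.surjective l
    have hag : ∀ i < finProdFinEquiv (j, r), x i = y i := fun i hi => by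
      by_contra h
      exact hmin i h hi
    rw [if_neg hxy, zero_add]
    refine le_trans ?_ (Finset.single_le_sum (fun p _ => hnonneg p) (Finset.mem_univ (j, r)))
    rw [if_pos hag]
    exact ENNReal.toReal_le_of_le_ofReal (by positivity)
      (cubeMeasure_blockIncreasing_inter_le hs hns hl)

lemma sum_pow_sub_le {n : ℕ} {M : ℝ} (hM : 1 < M) :
    ∑ j : Fin n, M ^ (n - 1 - j) ≤ M ^ n / (M - 1) := by
  rw [Fin.sum_univ_eq_sum_range (fun j => M ^ (n - 1 - j)) n,
    Finset.sum_range_reflect (fun j => M ^ j) n, geom_sum_eq hM.ne']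
  have : 0 < M - 1 := by linarith
  gcongr
  linarith

/-- The number of block-increasing paths is positive with probability bounded below uniformly
in the depth, provided that the mean number per block is greater than one. -/
lemma one_le_mul_measureReal_iUnion_blockIncreasing {D m n : ℕ} {s L M : ℝ} (hs : 0 < s)
    (hns : n * s ≤ 1) (hD : 0 < D) (hL : D * s = L) (hLM : L ^ m / m.factorial = M)
    (hM : 1 < M) :
    1 ≤ (1 + m * max 1 L ^ m / (M - 1)) *
      (cubeMeasure (TreeEdge D (n * m))).real (⋃ x, blockIncreasing D n m s x) := by
  set μ := cubeMeasure (TreeEdge D (n * m))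
  set V : ℝ := s ^ m / m.factorial with hV
  have hVpos : 0 < V := by positivity
  have hDr : (0:ℝ) < D := by exact_mod_cast hD
  have hMV : (D:ℝ) ^ m * V = M := by
    rw [← hLM, ← hL, hV, mul_pow]
    ring
  have hLpos : 0 < L := by rw [← hL]; positivity
  have hM1 : 0 < M - 1 := by linarith
  have hA : ∀ x, μ.real (blockIncreasing D n m s x) = V ^ n := fun x => by
    rw [measureReal_def, cubeMeasure_blockIncreasing D m hs.le hns,
      ENNReal.toReal_ofReal (by positivity)]
  have hrow : ∀ x, ∑ y, μ.real (blockIncreasing D n m s x ∩ blockIncreasing D n m s y) ≤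
      V ^ n * (M ^ n * (1 + m * max 1 L ^ m / (M - 1))) := by
    intro x
    have hterm : ∀ p : Fin n × Fin m, (D : ℝ) ^ (n * m - finProdFinEquiv p) *
        (V ^ n * (s ^ (m - p.2) * V ^ (n - 1 - p.1))) ≤
        V ^ n * (max 1 L ^ m * M ^ (n - 1 - p.1)) := by
      rintro ⟨j, r⟩
      have hexp : n * m - (finProdFinEquiv (j, r)).1 = (m - r.1) + m * (n - 1 - j.1) := by
        rw [finProdFinEquiv_apply_val]
        obtain ⟨d, hd⟩ := Nat.exists_eq_add_of_lt j.2
        have hr := r.2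
        have hnd : n - 1 - j.1 = d := by lia
        have hnm : n * m = m * j.1 + m * d + m := (congrArg (· * m) hd).trans (by ring)
        simp only [hnd]
        omega
      have hpow : L ^ (m - r.1) ≤ max 1 L ^ m :=
        (pow_le_pow_left₀ hLpos.le (le_max_right _ _) _).trans
          (pow_le_pow_right₀ (le_max_left _ _) (Nat.sub_le _ _))
      calc _ = V ^ n * (L ^ (m - r.1) * M ^ (n - 1 - j.1)) := by
            rw [hexp, ← hL, ← hMV, pow_add, pow_mul, mul_pow, mul_pow]
            ring
        _ ≤ _ := by gcongr
    calc _ ≤ ∑ y, _ := Finset.sum_le_sum fun y _ =>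
          measureReal_blockIncreasing_inter_le hs.le hns x y
      _ = V ^ n + ∑ p : Fin n × Fin m, (D : ℝ) ^ (n * m - finProdFinEquiv p) *
          (V ^ n * (s ^ (m - p.2) * V ^ (n - 1 - p.1))) := by
        rw [Finset.sum_add_distrib, Finset.sum_ite_eq, if_pos (Finset.mem_univ _),
          Finset.sum_comm]
        congr 1
        refine Finset.sum_congr rfl fun p _ => ?_
        rw [← Finset.sum_filter, Finset.sum_const, card_filter_agree_below, nsmul_eq_mul]
        push_cast
        rfl
      _ ≤ V ^ n + ∑ p : Fin n × Fin m, V ^ n * (max 1 L ^ m * M ^ (n - 1 - p.1)) := by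
        exact add_le_add le_rfl (Finset.sum_le_sum fun p _ => hterm p)
      _ = V ^ n * (1 + m * max 1 L ^ m * ∑ j : Fin n, M ^ (n - 1 - j)) := by
        rw [Fintype.sum_prod_type]
        simp only [Finset.sum_const, Finset.card_univ, Fintype.card_fin, nsmul_eq_mul]
        rw [mul_add, mul_one, Finset.mul_sum, Finset.mul_sum]
        congr 1
        exact Finset.sum_congr rfl fun _ _ => by ring
      _ ≤ V ^ n * (M ^ n + m * max 1 L ^ m * (M ^ n / (M - 1))) := by
        gcongr
        · exact one_le_pow₀ hM.le
        · exact sum_pow_sub_le hM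
      _ = _ := by ring
  have hsm := sq_sum_measureReal_le μ fun x => measurableSet_blockIncreasing D n m s x
  have hsum : ∑ x, μ.real (blockIncreasing D n m s x) = M ^ n := by
    simp_rw [hA]
    rw [Finset.sum_const, Finset.card_univ, Fintype.card_fun, Fintype.card_fin,
      Fintype.card_fin, nsmul_eq_mul, ← hMV, mul_pow, ← pow_mul, mul_comm n m]
    push_cast
    rfl
  have hsum2 : ∑ x, ∑ y, μ.real (blockIncreasing D n m s x ∩ blockIncreasing D n m s y) ≤
      M ^ n * (M ^ n * (1 + m * max 1 L ^ m / (M - 1))) := by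
    refine (Finset.sum_le_sum fun x _ => hrow x).trans_eq ?_
    rw [← Finset.sum_mul, ← hsum]
    simp_rw [hA]
  rw [hsum] at hsm
  have hMn : 0 < M ^ n * M ^ n := by positivity
  have := hsm.trans (mul_le_mul_of_nonneg_right hsum2 measureReal_nonneg)
  refine le_of_mul_le_mul_left ?_ hMn
  calc M ^ n * M ^ n * 1 = (M ^ n) ^ 2 := by ring
    _ ≤ _ := this
    _ = _ := by ring

lemma strictMono_of_mem_blockIncreasing {D n m : ℕ} {s : ℝ} (hs : 0 ≤ s)
    {x : Fin (n * m) → Fin D} {ℓ : TreeEdge D (n * m) → ℝ} (hℓ : ℓ ∈ blockIncreasing D n m s x) :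
    StrictMono fun i => ℓ (edgeOfLeaf D (n * m) x i) := by
  intro i i' hi
  obtain ⟨⟨j, r⟩, rfl⟩ := finProdFinEquiv.surjective i
  obtain ⟨⟨j', r'⟩, rfl⟩ := finProdFinEquiv.surjective i'
  rcases lt_trichotomy j j' with h | rfl | h
  · have h1 := ((hℓ j).2 r).2
    have h2 := ((hℓ j').2 r').1
    have h3 : ((j.1 + 1 : ℕ) : ℝ) ≤ j'.1 := Nat.cast_le.2 h
    push_cast at h3
    exact h1.trans_le ((mul_le_mul_of_nonneg_right h3 hs).trans h2.le)
  · refine (hℓ j).1 (lt_of_not_ge fun h => ?_)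
    exact absurd (finProdFinEquiv_le_of_le (.inr ⟨rfl, h⟩)) (not_le.2 hi)
  · exact absurd (finProdFinEquiv_le_of_le (.inl h)) (not_le.2 hi)

/-- Cutting a deeper tree down to its first `k` levels. -/
lemma cubeMeasure_iUnion_blockIncreasing_le {D n m k : ℕ} {s T : ℝ} (hs : 0 ≤ s)
    (hnT : n * s ≤ T) (hk : k ≤ n * m) :
    cubeMeasure (TreeEdge D (n * m)) (⋃ x, blockIncreasing D n m s x) ≤
      cubeMeasure (TreeEdge D k) {ℓ : TreeEdge D k → ℝ | ∃ x : Fin k → Fin D,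
        (StrictMono fun i => ℓ (edgeOfLeaf D k x i)) ∧
          ∀ i : Fin k, ℓ (edgeOfLeaf D k x i) < T} := by
  let f : TreeEdge D k → TreeEdge D (n * m) := fun e => ⟨Fin.castLE hk e.1, e.2⟩
  have hf : f.Injective := by
    rintro ⟨i, a⟩ ⟨i', a'⟩ h
    obtain rfl : i = i' := Fin.castLE_injective hk (congrArg Sigma.fst h)
    have := eq_of_heq (Sigma.mk.inj h).2
    subst this
    rfl
  have hmp := measurePreserving_cubeMeasure_comp hf
  rw [← hmp.map_eq]
  refine le_trans (measure_mono fun ℓ hℓ => ?_) (Measure.le_map_apply hmp.aemeasurable _)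
  obtain ⟨x, hx⟩ := Set.mem_iUnion.1 hℓ
  have hmono := strictMono_of_mem_blockIncreasing hs hx
  refine ⟨fun i => x (Fin.castLE hk i), fun i i' hi => ?_, fun i => ?_⟩
  · exact hmono (Fin.strictMono_castLE hk hi)
  · change ℓ (edgeOfLeaf D (n * m) x (Fin.castLE hk i)) < T
    obtain ⟨⟨j, r⟩, hjr⟩ := finProdFinEquiv.surjective (Fin.castLE hk i)
    rw [← hjr]
    have h3 : ((j.1 + 1 : ℕ) : ℝ) ≤ n := Nat.cast_le.2 j.2
    push_cast at h3
    exact ((hx j).2 r).2.trans_le ((mul_le_mul_of_nonneg_right h3 hs).trans hnT)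

/-- A single path succeeds with probability at least `(T / k) ^ k`. -/
lemma ofReal_div_pow_le_cubeMeasure {D k : ℕ} (hD : 0 < D) (hk : 1 ≤ k) {T : ℝ} (hT : 0 ≤ T)
    (hT1 : T ≤ 1) :
    ENNReal.ofReal ((T / k) ^ k) ≤
      cubeMeasure (TreeEdge D k) {ℓ : TreeEdge D k → ℝ | ∃ x : Fin k → Fin D,
        (StrictMono fun i => ℓ (edgeOfLeaf D k x i)) ∧
          ∀ i : Fin k, ℓ (edgeOfLeaf D k x i) < T} := by
  have hk0 : (0:ℝ) < k := by exact_mod_cast hk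
  have hkT : k * (T / k) = T := by field_simp
  refine le_trans ?_ (cubeMeasure_iUnion_blockIncreasing_le (n := k) (m := 1)
    (by positivity : 0 ≤ T / k) hkT.le (by simp))
  have h := cubeMeasure_blockIncreasing D 1 (by positivity : 0 ≤ T / k) (hkT.le.trans hT1)
    (fun _ => ⟨0, hD⟩)
  simp only [pow_one, Nat.factorial_one, Nat.cast_one, div_one] at h
  rw [← h]
  exact measure_mono (Set.subset_iUnion (blockIncreasing D k 1 (T / k)) _)

lemma exists_one_lt_pow_div_factorial {ρ : ℝ} (hρ : 1 < ρ) :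
    ∃ m : ℕ, 1 ≤ m ∧ 1 < (m * ρ / Real.exp 1) ^ m / m.factorial := by
  have ht : Tendsto (fun m : ℕ => (m : ℝ) ^ 1 / ρ ^ m) atTop (𝓝 0) :=
    tendsto_pow_const_div_const_pow_of_one_lt 1 hρ
  obtain ⟨m, hm1, hm⟩ := ((eventually_ge_atTop 1).and
    (ht.eventually_lt_const (inv_pos.2 (Real.exp_pos 1)))).exists
  refine ⟨m, hm1, ?_⟩
  have hmr : (1:ℝ) ≤ m := by exact_mod_cast hm1
  have hpow : Real.exp 1 * m < ρ ^ m := by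
    rw [pow_one, div_lt_iff₀ (by positivity), inv_mul_eq_div, lt_div_iff₀ (Real.exp_pos 1)] at hm
    linarith
  have hst : Stirling.stirlingSeq m ≤ Real.exp 1 / √2 := by
    obtain ⟨m', rfl⟩ := Nat.exists_eq_add_of_le' hm1
    rw [← Stirling.stirlingSeq_one]
    exact Stirling.stirlingSeq'_antitone (Nat.zero_le m')
  have hE : 0 < (m / Real.exp 1) ^ m := by positivity
  rw [Stirling.stirlingSeq, div_le_iff₀ (by positivity)] at hst
  have hsq : √(m : ℝ) ≤ m := (Real.sqrt_le_left (by positivity)).2 (by nlinarith)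
  rw [one_lt_div (by positivity)]
  calc (m.factorial : ℝ) ≤ Real.exp 1 / √2 * (√(2 * m) * (m / Real.exp 1) ^ m) := hst
    _ = Real.exp 1 * √m * (m / Real.exp 1) ^ m := by
      rw [Real.sqrt_mul (by norm_num)]
      field_simp
    _ ≤ Real.exp 1 * m * (m / Real.exp 1) ^ m := by gcongr
    _ < ρ ^ m * (m / Real.exp 1) ^ m := by gcongr
    _ = (m * ρ / Real.exp 1) ^ m := by
      rw [← mul_pow]
      ring

/-- for every sufficiently small fixed `ε > 0` there is `c > 0` such that for
all `D` and all `1 ≤ k ≤ (1−ε)·e·D`, if the edges of `T_D^k` get i.i.d. uniform `[0,1]`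
labels, then with probability at least `c/k^{3/2}` some root-to-leaf path has increasing
labels, all smaller than `1 − ε/2`. -/
theorem increasing_truncated_path_probability :
    ∃ ε₀ : ℝ, 0 < ε₀ ∧ ∀ ε : ℝ, 0 < ε → ε ≤ ε₀ →
      ∃ c : ℝ, 0 < c ∧ ∀ D k : ℕ, 1 ≤ k → (k : ℝ) ≤ (1 - ε) * Real.exp 1 * D →
        ENNReal.ofReal (c / (k : ℝ) ^ ((3 : ℝ) / 2)) ≤
          cubeMeasure (TreeEdge D k)
            {ℓ : TreeEdge D k → ℝ | ∃ x : Fin k → Fin D,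
              (StrictMono fun i => ℓ (edgeOfLeaf D k x i)) ∧
              ∀ i : Fin k, ℓ (edgeOfLeaf D k x i) < 1 - ε / 2} := by
  refine ⟨1 / 2, by norm_num, fun ε hε hε₀ => ?_⟩
  set T : ℝ := 1 - ε / 2 with hT
  have hT0 : 0 < T := by linarith
  have hT1 : T ≤ 1 := by linarith
  have hq : 0 < 1 - 3 * ε / 4 := by linarith
  obtain ⟨m, hm1, hm⟩ := exists_one_lt_pow_div_factorial
    (ρ := T / (1 - 3 * ε / 4)) (by rw [one_lt_div hq]; linarith)
  set L : ℝ := m * (T / (1 - 3 * ε / 4)) / Real.exp 1 with hL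
  set M : ℝ := L ^ m / m.factorial with hM
  have hM1 : 0 < M - 1 := by linarith
  have hm0 : (0:ℝ) < m := by exact_mod_cast hm1
  have hL0 : 0 < L := by positivity
  set C : ℝ := 1 + m * max 1 L ^ m / (M - 1)
  have hC0 : 0 < C := by
    have : 0 < max 1 L := lt_max_of_lt_left one_pos
    positivity
  set D₀ : ℕ := ⌈2 * m / ε⌉₊ + 1 with hD₀
  have hK : (0:ℝ) < (3 * D₀ : ℕ) := by positivity
  refine ⟨min (1 / C) ((T / (3 * D₀ : ℕ)) ^ (3 * D₀)), by positivity, fun D k hk hkD => ?_⟩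
  have he2 : 2 ≤ Real.exp 1 := by have := Real.exp_one_gt_d9; linarith
  have he3 : Real.exp 1 ≤ 3 := by have := Real.exp_one_lt_d9; linarith
  have hk1 : (1:ℝ) ≤ k := by exact_mod_cast hk
  have hD : 0 < D := by
    refine Nat.pos_of_ne_zero fun h => ?_
    rw [h] at hkD
    norm_num at hkD
    lia
  have hDr : (0:ℝ) < D := by exact_mod_cast hD
  refine (ENNReal.ofReal_le_ofReal (div_le_self (by positivity)
    (Real.one_le_rpow hk1 (by norm_num)))).trans ?_
  by_cases hDD : D < D₀
  · refine le_trans (ENNReal.ofReal_le_ofReal ?_) (ofReal_div_pow_le_cubeMeasure hD hk hT0.le hT1)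
    have hkK : k ≤ 3 * D₀ := by
      have h1 : (k:ℝ) ≤ 3 * D := by
        refine hkD.trans ?_
        gcongr
        nlinarith
      have h2 : k ≤ 3 * D := by exact_mod_cast h1
      lia
    have hkKr : (k:ℝ) ≤ (3 * D₀ : ℕ) := by exact_mod_cast hkK
    calc _ ≤ (T / (3 * D₀ : ℕ)) ^ (3 * D₀) := min_le_right _ _
      _ ≤ (T / (3 * D₀ : ℕ)) ^ k := pow_le_pow_of_le_one (by positivity)
        ((div_le_one hK).2 (by linarith)) hkK
      _ ≤ (T / k) ^ k := by gcongr
  · have hDm : m ≤ ε * D / 2 := by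
      have h1 : (D₀:ℝ) ≤ D := by exact_mod_cast not_lt.1 hDD
      have h2 : 2 * m / ε ≤ D := by
        refine (Nat.le_ceil _).trans (le_trans ?_ h1)
        rw [hD₀]
        push_cast
        linarith
      rw [div_le_iff₀ hε] at h2
      linarith
    have hkn : k ≤ (k / m + 1) * m := by
      rw [add_mul, one_mul]
      exact (Nat.lt_div_mul_add hm1).le
    have hns : ((k / m + 1 : ℕ) : ℝ) * (L / D) ≤ T := by
      have h1 : ((k / m + 1 : ℕ) : ℝ) * m ≤ k + m := by
        have : (k / m + 1) * m ≤ k + m := by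
          rw [add_mul, one_mul]
          exact Nat.add_le_add_right (Nat.div_mul_le_self k m) m
        exact_mod_cast this
      have h2 : (k + m : ℝ) ≤ (1 - 3 * ε / 4) * Real.exp 1 * D := by
        have : 0 ≤ ε * D * (Real.exp 1 - 2) := by
          have : 0 ≤ Real.exp 1 - 2 := by linarith
          positivity
        linarith
      calc ((k / m + 1 : ℕ) : ℝ) * (L / D)
          = ((k / m + 1 : ℕ) : ℝ) * m * (T / ((1 - 3 * ε / 4) * Real.exp 1 * D)) := by
            rw [hL]
            field_simp
        _ ≤ (1 - 3 * ε / 4) * Real.exp 1 * D * (T / ((1 - 3 * ε / 4) * Real.exp 1 * D)) := by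
            exact mul_le_mul_of_nonneg_right (h1.trans h2) (by positivity)
        _ = T := mul_div_cancel₀ T (by positivity)
    refine le_trans ?_ (cubeMeasure_iUnion_blockIncreasing_le (by positivity) hns hkn)
    have hone := one_le_mul_measureReal_iUnion_blockIncreasing (m := m) (by positivity)
      (hns.trans hT1) hD (mul_div_cancel₀ L hDr.ne') hM.symm hm
    refine (ENNReal.ofReal_le_ofReal
      ((min_le_left _ _).trans ((div_le_iff₀' hC0).2 hone))).trans ?_
    exact (ofReal_measureReal).le
end

section
/- Let k ≥ 1, let 0 < δ < 1 with δ + 1/k < 1, and let X_1, …, X_k be i.i.d. random variables uniform on [0,1]. Then the probability of the event {X_1 ≤ X_2 ≤ ⋯ ≤ X_k, and 1 − δ − 1/k ≤ X_k ≤ 1 − δ, and X_i ≥ (i/k)·X_k for every 1 ≤ i ≤ k} equals (1/(k·k!))·[(1−δ)^k − (1−δ−1/k)^k]. -/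
open MeasureTheory Filter Topology
open scoped ENNReal

/-- Fubini for a finite power of `volume`, slicing along the last coordinate. -/
theorem volume_eq_lintegral_snoc {n : ℕ} {S : Set (Fin (n + 1) → ℝ)} (hS : MeasurableSet S) :
    volume S = ∫⁻ x : ℝ, volume {Y : Fin n → ℝ | (Fin.snoc Y x : Fin (n + 1) → ℝ) ∈ S} := by
  have e := (volume_preserving_piFinSuccAbove (fun _ : Fin (n + 1) => ℝ) (Fin.last n)).symm
  rw [← e.measure_preimage hS.nullMeasurableSet, Measure.volume_eq_prod,
    Measure.prod_apply (e.measurable hS)]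
  refine lintegral_congr fun x => ?_
  congr 1
  ext Y
  simp [MeasurableEquiv.piFinSuccAbove, Fin.insertNthEquiv, Fin.insertNth_last']

/-- The nondecreasing sequences bounded above by `t` whose `i`-th term is at least `i * c`. -/
def monotoneAboveLine (n : ℕ) (c t : ℝ) : Set (Fin n → ℝ) :=
  {Y | Monotone Y ∧ (∀ i, Y i ≤ t) ∧ ∀ i : Fin n, (i.1 + 1 : ℝ) * c ≤ Y i}

theorem measurableSet_monotoneAboveLine (n : ℕ) (c t : ℝ) :
    MeasurableSet (monotoneAboveLine n c t) := by
  refine IsClosed.measurableSet ?_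
  simp only [monotoneAboveLine, Set.ofPred_and, Set.ofPred_forall]
  exact isClosed_monotone.inter
    ((isClosed_iInter fun i => isClosed_le (continuous_apply i) continuous_const).inter
      (isClosed_iInter fun i => isClosed_le continuous_const (continuous_apply i)))

theorem monotone_snoc_iff {n : ℕ} (Y : Fin n → ℝ) (x : ℝ) :
    Monotone (Fin.snoc Y x : Fin (n + 1) → ℝ) ↔ Monotone Y ∧ ∀ i, Y i ≤ x := by
  constructor
  · intro h
    refine ⟨fun i j hij => ?_, fun i => ?_⟩
    · simpa using h (Fin.castSucc_le_castSucc_iff.2 hij)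
    · simpa using h (Fin.le_last i.castSucc)
  · rintro ⟨h, hx⟩ i j hij
    induction j using Fin.lastCases with
    | last => induction i using Fin.lastCases with
      | last => simp
      | cast i => simpa using hx i
    | cast j => induction i using Fin.lastCases with
      | last => exact absurd hij (not_le.2 (Fin.castSucc_lt_last j))
      | cast i => simpa using h (Fin.castSucc_le_castSucc_iff.1 hij)

theorem snoc_mem_monotoneAboveLine_iff {n : ℕ} {c t x : ℝ} (Y : Fin n → ℝ) :
    (Fin.snoc Y x : Fin (n + 1) → ℝ) ∈ monotoneAboveLine (n + 1) c t ↔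
      x ∈ Set.Icc (((n + 1 : ℕ) : ℝ) * c) t ∧ Y ∈ monotoneAboveLine n c x := by
  simp only [monotoneAboveLine, Set.mem_ofPred_eq, monotone_snoc_iff, Fin.forall_fin_succ',
    Fin.snoc_castSucc, Fin.snoc_last, Fin.val_castSucc, Fin.val_last, Set.mem_Icc, Nat.cast_add,
    Nat.cast_one]
  constructor
  · rintro ⟨⟨h1, h2⟩, ⟨h3, h4⟩, h5, h6⟩
    exact ⟨⟨h6, h4⟩, h1, h2, h5⟩
  · rintro ⟨⟨h6, h4⟩, h1, h2, h5⟩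
    exact ⟨⟨h1, h2⟩, ⟨fun i => (h2 i).trans h4, h4⟩, h5, h6⟩

/-- Integrating slice volumes that vanish off an interval, by the fundamental theorem of
calculus. -/
theorem lintegral_slices_eq {n : ℕ} {a b : ℝ} (hab : a ≤ b) {F f : ℝ → ℝ}
    (hF : ∀ x, HasDerivAt F (f x) x) (hf : Continuous f) (h0 : ∀ x ∈ Set.Icc a b, 0 ≤ f x)
    {T : ℝ → Set (Fin n → ℝ)} (hT : ∀ x ∈ Set.Icc a b, volume (T x) = ENNReal.ofReal (f x)) :
    ∫⁻ x : ℝ, volume {Y : Fin n → ℝ | x ∈ Set.Icc a b ∧ Y ∈ T x} =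
      ENNReal.ofReal (F b - F a) := by
  have h1 : ∀ x : ℝ, volume {Y : Fin n → ℝ | x ∈ Set.Icc a b ∧ Y ∈ T x} =
      (Set.Icc a b).indicator (fun x => ENNReal.ofReal (f x)) x := by
    intro x
    by_cases hx : x ∈ Set.Icc a b
    · rw [Set.indicator_of_mem hx, ← hT x hx]
      simp only [hx, true_and, Set.ofPred_mem_eq]
    · simp only [Set.indicator_of_notMem hx, hx, false_and, Set.ofPred_false, measure_empty]
  rw [lintegral_congr h1, lintegral_indicator measurableSet_Icc,
    ← ofReal_integral_eq_lintegral_ofReal hf.integrableOn_Icc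
      (ae_restrict_of_forall_mem measurableSet_Icc h0),
    integral_Icc_eq_integral_Ioc, ← intervalIntegral.integral_of_le hab,
    intervalIntegral.integral_eq_sub_of_hasDerivAt (fun x _ => hF x) (hf.intervalIntegrable a b)]

/-- The volume is given by the Abel-type (Gončarov) polynomial with nodes `c, 2c, …, nc`. -/
theorem volume_monotoneAboveLine (n : ℕ) {c : ℝ} (hc : 0 ≤ c) {t : ℝ} (ht : n * c ≤ t) :
    volume (monotoneAboveLine n c t) =
      ENNReal.ofReal ((t ^ n - n * c * t ^ (n - 1)) / n.factorial) := by
  induction n generalizing t with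
  | zero =>
    have : monotoneAboveLine 0 c t = Set.univ := by
      ext Y
      simp [monotoneAboveLine, Subsingleton.monotone]
    simp [this, volume_pi]
  | succ n ih =>
    have hn : (n : ℝ) * c ≤ ((n + 1 : ℕ) : ℝ) * c := by
      push_cast
      linarith
    have hnc : 0 ≤ (n : ℝ) * c := by positivity
    rw [volume_eq_lintegral_snoc (measurableSet_monotoneAboveLine _ _ _)]
    simp only [snoc_mem_monotoneAboveLine_iff]
    rw [lintegral_slices_eq (f := fun x => (x ^ n - n * c * x ^ (n - 1)) / n.factorial)
      (F := fun x => (x ^ (n + 1) - (n + 1 : ℕ) * c * x ^ n) / (n + 1).factorial) ht]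
    · simp only [Nat.add_sub_cancel]
      congr 1
      ring
    · intro x
      have h := (((hasDerivAt_pow (n + 1) x).sub
        ((hasDerivAt_pow n x).const_mul (((n + 1 : ℕ) : ℝ) * c))).div_const
          ((n + 1).factorial : ℝ))
      refine h.congr_deriv ?_
      have : (n.factorial : ℝ) ≠ 0 := by positivity
      rw [Nat.factorial_succ]
      push_cast
      field_simp
    · fun_prop
    · intro x hx
      have hx' : n * c ≤ x := hn.trans hx.1
      refine div_nonneg ?_ (by positivity)
      cases n with
      | zero => simp
      | succ m =>
        have hp := mul_nonneg (sub_nonneg.2 hx') (pow_nonneg (hnc.trans hx') m)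
        simp only [Nat.add_sub_cancel, pow_succ]
        nlinarith
    · exact fun x hx => ih (hn.trans hx.1)

/-- for i.i.d. uniform `[0,1]` variables `X_1,…,X_k`, the probability of
`{X_1 ≤ ⋯ ≤ X_k, 1−δ−1/k ≤ X_k ≤ 1−δ, and X_i ≥ (i/k)·X_k for all i}` equals
`(1/(k·k!))·((1−δ)^k − (1−δ−1/k)^k)`. -/
theorem probability_good_tuple
    (k : ℕ) (hk : 1 ≤ k) (δ : ℝ) (hδ0 : 0 < δ) (hδ1 : δ < 1)
    (hδk : δ + 1 / (k : ℝ) < 1) :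
    cubeMeasure (Fin k)
      {X : Fin k → ℝ |
        (∀ i j : Fin k, i ≤ j → X i ≤ X j) ∧
        (1 - δ - 1 / (k : ℝ) ≤ X ⟨k - 1, Nat.sub_lt hk Nat.one_pos⟩) ∧
        (X ⟨k - 1, Nat.sub_lt hk Nat.one_pos⟩ ≤ 1 - δ) ∧
        (∀ i : Fin k, ((i.1 + 1 : ℝ) / (k : ℝ)) * X ⟨k - 1, Nat.sub_lt hk Nat.one_pos⟩ ≤ X i)}
      = ENNReal.ofReal (1 / ((k : ℝ) * Nat.factorial k) *
          ((1 - δ) ^ k - (1 - δ - 1 / (k : ℝ)) ^ k)) := by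
  obtain ⟨n, rfl⟩ : ∃ n, k = n + 1 := ⟨k - 1, by omega⟩
  have hlast : (⟨n + 1 - 1, Nat.sub_lt hk Nat.one_pos⟩ : Fin (n + 1)) = Fin.last n := rfl
  have hkpos : (0 : ℝ) < ((n + 1 : ℕ) : ℝ) := by positivity
  have hinv : 0 < 1 / ((n + 1 : ℕ) : ℝ) := by positivity
  simp only [hlast]
  set S : Set (Fin (n + 1) → ℝ) := {X | (∀ i j, i ≤ j → X i ≤ X j) ∧
    (1 - δ - 1 / ((n + 1 : ℕ) : ℝ) ≤ X (Fin.last n)) ∧ (X (Fin.last n) ≤ 1 - δ) ∧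
    ∀ i : Fin (n + 1), ((i.1 + 1 : ℝ) / ((n + 1 : ℕ) : ℝ)) * X (Fin.last n) ≤ X i} with hS
  have hcube : S ⊆ Set.univ.pi fun _ => Set.Icc (0 : ℝ) 1 := by
    rintro X ⟨h1, h2, h3, h4⟩ i -
    have hpos : 0 ≤ X (Fin.last n) := by linarith
    exact ⟨le_trans (by positivity) (h4 i), by linarith [h1 i _ (Fin.le_last i)]⟩
  have hmeas : MeasurableSet S := by
    refine IsClosed.measurableSet ?_
    simp only [hS, Set.ofPred_and, Set.ofPred_forall]
    exact (isClosed_iInter fun i => isClosed_iInter fun j => isClosed_iInter fun _ =>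
        isClosed_le (continuous_apply i) (continuous_apply j)).inter
      ((isClosed_le continuous_const (continuous_apply _)).inter
        ((isClosed_le (continuous_apply _) continuous_const).inter
          (isClosed_iInter fun i =>
            isClosed_le (continuous_const.mul (continuous_apply _)) (continuous_apply i))))
  have hslice : ∀ (x : ℝ) (Y : Fin n → ℝ), (Fin.snoc Y x : Fin (n + 1) → ℝ) ∈ S ↔
      x ∈ Set.Icc (1 - δ - 1 / ((n + 1 : ℕ) : ℝ)) (1 - δ) ∧
        Y ∈ monotoneAboveLine n (x / ((n + 1 : ℕ) : ℝ)) x := by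
    intro x Y
    have hmono : (∀ i j : Fin (n + 1), i ≤ j →
        (Fin.snoc Y x : Fin (n + 1) → ℝ) i ≤ (Fin.snoc Y x : Fin (n + 1) → ℝ) j) ↔
        Monotone Y ∧ ∀ i, Y i ≤ x := by
      rw [← monotone_snoc_iff]
      rfl
    have hself : ((n : ℝ) + 1) * x / ((n + 1 : ℕ) : ℝ) ≤ x := by
      rw [Nat.cast_add_one, mul_div_cancel_left₀ _ (by positivity)]
    rw [hS, Set.mem_ofPred_eq, hmono]
    simp only [Set.mem_ofPred_eq, monotoneAboveLine, Fin.forall_fin_succ',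
      Fin.snoc_castSucc, Fin.snoc_last, Fin.val_castSucc, Fin.val_last, Set.mem_Icc,
      mul_div_assoc', div_mul_eq_mul_div, hself, and_true]
    tauto
  rw [cubeMeasure, ← Measure.restrict_pi_pi, Measure.restrict_apply hmeas,
    Set.inter_eq_left.2 hcube, ← volume_pi, volume_eq_lintegral_snoc hmeas]
  simp only [hslice]
  rw [lintegral_slices_eq (f := fun x => x ^ n / (n + 1).factorial)
    (F := fun x => x ^ (n + 1) / ((n + 1 : ℕ) * (n + 1).factorial)) (by linarith)]
  · congr 1
    ring
  · intro x
    refine ((hasDerivAt_pow (n + 1) x).div_const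
      (((n + 1 : ℕ) : ℝ) * (n + 1).factorial)).congr_deriv ?_
    simp only [Nat.add_sub_cancel]
    field_simp
  · fun_prop
  · intro x hx
    have : 0 ≤ x := by linarith [hx.1]
    positivity
  · intro x hx
    have hx0 : 0 ≤ x := by linarith [hx.1]
    rw [volume_monotoneAboveLine n (by positivity)]
    · congr 1
      rw [Nat.factorial_succ]
      cases n with
      | zero => simp
      | succ m =>
        have : ((m + 1).factorial : ℝ) ≠ 0 := by positivity
        simp only [Nat.add_sub_cancel]
        push_cast
        field_simp
        ring
    · rw [mul_div_assoc', div_le_iff₀ hkpos]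
      push_cast
      nlinarith
end

section
/- Let k ≥ 1 and let X_1, …, X_k be i.i.d. random variables uniform on [0,1]. Then the probability of the event {X_1 ≤ X_2 ≤ ⋯ ≤ X_k and X_i ≥ (i/k)·X_k for every 1 ≤ i ≤ k} equals 1/(k·k!). -/
open MeasureTheory Filter Topology
open scoped ENNReal

/-- Fubini for `cubeMeasure`, integrating over the last coordinate last. -/
lemma cubeMeasure_succ_apply {n : ℕ} {S : Set (Fin (n + 1) → ℝ)} (hS : MeasurableSet S) :
    cubeMeasure (Fin (n + 1)) S =
      ∫⁻ t in Set.Icc (0 : ℝ) 1,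
        cubeMeasure (Fin n) {u | Fin.snoc (α := fun _ => ℝ) u t ∈ S} := by
  have h := (measurePreserving_piFinSuccAbove
    (fun _ : Fin (n + 1) => (volume : Measure ℝ).restrict (Set.Icc (0 : ℝ) 1)) (Fin.last n)).symm
  unfold cubeMeasure
  rw [← h.measure_preimage hS.nullMeasurableSet,
    Measure.prod_apply (h.measurable hS)]
  refine lintegral_congr fun t => ?_
  congr 1
  ext u
  simp [MeasurableEquiv.piFinSuccAbove, Fin.insertNthEquiv, Fin.insertNth_last']

/-- The nondecreasing sequences bounded by `x` whose `i`-th term (from `i = 1`) is at least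
`i * c`. -/
def sequencesAboveLine (n : ℕ) (c x : ℝ) : Set (Fin n → ℝ) :=
  {u | (∀ i j : Fin n, i ≤ j → u i ≤ u j) ∧ (∀ i : Fin n, (i.1 + 1 : ℝ) * c ≤ u i) ∧
    ∀ i : Fin n, u i ≤ x}

lemma measurableSet_sequencesAboveLine (n : ℕ) (c x : ℝ) :
    MeasurableSet (sequencesAboveLine n c x) := by
  refine IsClosed.measurableSet ?_
  simp only [sequencesAboveLine, Set.ofPred_and, Set.ofPred_forall]
  refine (isClosed_iInter fun i => isClosed_iInter fun j => isClosed_iInter fun _ => ?_).inter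
    ((isClosed_iInter fun i => ?_).inter (isClosed_iInter fun i => ?_)) <;>
  exact isClosed_le (by fun_prop) (by fun_prop)

lemma snoc_monotone_iff {n : ℕ} (u : Fin n → ℝ) (t : ℝ) :
    (∀ i j : Fin (n + 1), i ≤ j →
      Fin.snoc (α := fun _ => ℝ) u t i ≤ Fin.snoc (α := fun _ => ℝ) u t j) ↔
      (∀ i j : Fin n, i ≤ j → u i ≤ u j) ∧ ∀ i : Fin n, u i ≤ t := by
  constructor
  · intro h
    refine ⟨fun i j hij => ?_, fun i => ?_⟩
    · simpa using h i.castSucc j.castSucc (by simpa using hij)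
    · simpa using h i.castSucc (Fin.last n) (Fin.le_last _)
  · rintro ⟨h, ht⟩ i j hij
    induction j using Fin.lastCases with
    | last =>
      induction i using Fin.lastCases with
      | last => simp
      | cast i => simpa using ht i
    | cast j =>
      induction i using Fin.lastCases with
      | last => exact absurd hij (not_le.mpr (Fin.castSucc_lt_last j))
      | cast i => simpa using h i j (by simpa using hij)

lemma snoc_mem_sequencesAboveLine_iff {n : ℕ} (c x t : ℝ) (u : Fin n → ℝ) :
    Fin.snoc (α := fun _ => ℝ) u t ∈ sequencesAboveLine (n + 1) c x ↔
      u ∈ sequencesAboveLine n c t ∧ t ∈ Set.Icc ((n + 1 : ℝ) * c) x := by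
  simp only [sequencesAboveLine, Set.mem_ofPred_eq, snoc_monotone_iff]
  simp only [Fin.forall_fin_succ', Fin.snoc_castSucc, Fin.snoc_last, Fin.val_castSucc, Fin.val_last, Set.mem_Icc]
  constructor
  · rintro ⟨⟨h1, h2⟩, ⟨h3, h4⟩, h5, h6⟩
    exact ⟨⟨h1, h3, h2⟩, h4, h6⟩
  · rintro ⟨⟨h1, h3, h2⟩, h4, h6⟩
    exact ⟨⟨h1, h2⟩, ⟨h3, h4⟩, fun i => (h2 i).trans h6, h6⟩

/-- The volume polynomial of `sequencesAboveLine n c x` in `x`, equal to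
`x ^ (n - 1) * (x - n * c) / n!` for `n ≥ 1`. -/
noncomputable def abelPolynomial (n : ℕ) (c x : ℝ) : ℝ :=
  (x ^ n - n * c * x ^ (n - 1)) / n.factorial

lemma continuous_abelPolynomial (n : ℕ) (c : ℝ) : Continuous (abelPolynomial n c) := by
  unfold abelPolynomial
  fun_prop

lemma abelPolynomial_nonneg {n : ℕ} {c x : ℝ} (hc : 0 ≤ c) (hx : n * c ≤ x) :
    0 ≤ abelPolynomial n c x := by
  refine div_nonneg (sub_nonneg.mpr ?_) (by positivity)
  cases n with
  | zero => simp
  | succ n =>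
    have hx0 : 0 ≤ x := le_trans (by positivity) hx
    rw [Nat.add_sub_cancel, pow_succ']
    gcongr

lemma hasDerivAt_abelPolynomial_succ (n : ℕ) (c x : ℝ) :
    HasDerivAt (abelPolynomial (n + 1) c) (abelPolynomial n c x) x := by
  have h := ((hasDerivAt_pow (n + 1) x).sub
    ((hasDerivAt_pow n x).const_mul (((n + 1 : ℕ) : ℝ) * c))).div_const ((n + 1).factorial : ℝ)
  refine h.congr_deriv ?_
  have hn : (n.factorial : ℝ) ≠ 0 := by positivity
  simp only [abelPolynomial, Nat.factorial_succ, Nat.add_sub_cancel]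
  push_cast
  field_simp

lemma abelPolynomial_succ_self (n : ℕ) (c : ℝ) :
    abelPolynomial (n + 1) c ((n + 1 : ℝ) * c) = 0 := by
  simp only [abelPolynomial, Nat.add_sub_cancel]
  push_cast
  rw [pow_succ', sub_self, zero_div]

lemma setLIntegral_ofReal_Icc {f F : ℝ → ℝ} {a b : ℝ} (hab : a ≤ b) (hf : Continuous f)
    (hF : ∀ t, HasDerivAt F (f t) t) (hnonneg : ∀ t ∈ Set.Icc a b, 0 ≤ f t) :
    ∫⁻ t in Set.Icc a b, ENNReal.ofReal (f t) = ENNReal.ofReal (F b - F a) := by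
  rw [← intervalIntegral.integral_eq_sub_of_hasDerivAt (fun t _ => hF t)
    (hf.intervalIntegrable a b), intervalIntegral.integral_of_le hab,
    ← integral_Icc_eq_integral_Ioc,
    ofReal_integral_eq_lintegral_ofReal hf.continuousOn.integrableOn_Icc]
  exact (ae_restrict_iff' measurableSet_Icc).mpr (Eventually.of_forall hnonneg)

lemma cubeMeasure_sequencesAboveLine (n : ℕ) {c x : ℝ} (hc : 0 ≤ c) (hx : n * c ≤ x)
    (hx1 : x ≤ 1) :
    cubeMeasure (Fin n) (sequencesAboveLine n c x) = ENNReal.ofReal (abelPolynomial n c x) := by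
  induction n generalizing x with
  | zero =>
    have h : sequencesAboveLine 0 c x = Set.univ := by
      ext u
      simp [sequencesAboveLine]
    simp [h, cubeMeasure, abelPolynomial]
  | succ n ih =>
    push_cast at hx
    have hsub : Set.Icc ((n + 1 : ℝ) * c) x ⊆ Set.Icc 0 1 :=
      Set.Icc_subset_Icc (by positivity) hx1
    have hle : ∀ t ∈ Set.Icc ((n + 1 : ℝ) * c) x, n * c ≤ t := fun t ht =>
      le_trans (by nlinarith) ht.1
    have hslice : ∀ t, cubeMeasure (Fin n)
        {u | Fin.snoc (α := fun _ => ℝ) u t ∈ sequencesAboveLine (n + 1) c x} =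
        (Set.Icc ((n + 1 : ℝ) * c) x).indicator
          (fun t => ENNReal.ofReal (abelPolynomial n c t)) t := by
      intro t
      simp only [snoc_mem_sequencesAboveLine_iff]
      by_cases ht : t ∈ Set.Icc ((n + 1 : ℝ) * c) x
      · simp only [ht, and_true, Set.ofPred_mem_eq, Set.indicator_of_mem]
        exact ih (hle t ht) (ht.2.trans hx1)
      · simp [ht]
    rw [cubeMeasure_succ_apply (measurableSet_sequencesAboveLine _ _ _)]
    simp_rw [hslice]
    rw [setLIntegral_indicator measurableSet_Icc, Set.inter_eq_left.mpr hsub,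
      setLIntegral_ofReal_Icc hx (continuous_abelPolynomial n c)
        (hasDerivAt_abelPolynomial_succ n c) fun t ht => abelPolynomial_nonneg hc (hle t ht),
      abelPolynomial_succ_self, sub_zero]

lemma abelPolynomial_div_succ (n : ℕ) (t : ℝ) :
    abelPolynomial n (t / (n + 1)) t = t ^ n / (n + 1).factorial := by
  have hn : (n.factorial : ℝ) ≠ 0 := by positivity
  have hn1 : (n + 1 : ℝ) ≠ 0 := by positivity
  cases n with
  | zero => simp [abelPolynomial]
  | succ n =>
    rw [Nat.factorial_succ (n + 1)]
    simp only [abelPolynomial, Nat.add_sub_cancel]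
    push_cast at hn1 ⊢
    field_simp
    ring

/-- for i.i.d. uniform `[0,1]` variables `X_1,…,X_k`, the probability of
`{X_1 ≤ ⋯ ≤ X_k and X_i ≥ (i/k)·X_k for all 1 ≤ i ≤ k}` equals `1/(k·k!)`. -/
theorem probability_monotone_above_linear
    (k : ℕ) (hk : 1 ≤ k) :
    cubeMeasure (Fin k)
      {X : Fin k → ℝ |
        (∀ i j : Fin k, i ≤ j → X i ≤ X j) ∧
        (∀ i : Fin k, ((i.1 + 1 : ℝ) / (k : ℝ)) * X ⟨k - 1, Nat.sub_lt hk Nat.one_pos⟩ ≤ X i)}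
      = ENNReal.ofReal (1 / ((k : ℝ) * Nat.factorial k)) := by
  obtain ⟨n, rfl⟩ : ∃ n, k = n + 1 := ⟨k - 1, by omega⟩
  have hlast : (⟨n + 1 - 1, Nat.sub_lt hk Nat.one_pos⟩ : Fin (n + 1)) = Fin.last n := rfl
  simp only [hlast]
  have hmeas : MeasurableSet {X : Fin (n + 1) → ℝ | (∀ i j : Fin (n + 1), i ≤ j → X i ≤ X j) ∧
      ∀ i : Fin (n + 1), ((i.1 + 1 : ℝ) / ((n + 1 : ℕ) : ℝ)) * X (Fin.last n) ≤ X i} := by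
    refine IsClosed.measurableSet ?_
    simp only [Set.ofPred_and, Set.ofPred_forall]
    refine (isClosed_iInter fun i => isClosed_iInter fun j => isClosed_iInter fun _ => ?_).inter
      (isClosed_iInter fun i => ?_) <;>
    exact isClosed_le (by fun_prop) (by fun_prop)
  have hn1 : (n + 1 : ℝ) ≠ 0 := by positivity
  have hslice : ∀ t ∈ Set.Icc (0 : ℝ) 1, cubeMeasure (Fin n)
      {u | Fin.snoc (α := fun _ => ℝ) u t ∈ {X : Fin (n + 1) → ℝ |
        (∀ i j : Fin (n + 1), i ≤ j → X i ≤ X j) ∧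
        ∀ i : Fin (n + 1), ((i.1 + 1 : ℝ) / ((n + 1 : ℕ) : ℝ)) * X (Fin.last n) ≤ X i}} =
      ENNReal.ofReal (t ^ n / (n + 1).factorial) := by
    intro t ht
    rw [← abelPolynomial_div_succ, ← cubeMeasure_sequencesAboveLine n
      (div_nonneg ht.1 (by positivity)) ?_ ht.2]
    · congr 1
      ext u
      simp only [sequencesAboveLine, Set.mem_ofPred_eq, snoc_monotone_iff]
      simp only [Fin.forall_fin_succ', Fin.snoc_castSucc, Fin.snoc_last, Fin.val_castSucc,
        Fin.val_last, Nat.cast_add, Nat.cast_one, div_self hn1, one_mul, le_refl, and_true]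
      simp only [mul_comm_div]
      tauto
    · rw [← mul_div_assoc, div_le_iff₀ (by positivity)]
      nlinarith [ht.1]
  rw [cubeMeasure_succ_apply hmeas, setLIntegral_congr_fun measurableSet_Icc hslice,
    setLIntegral_ofReal_Icc (F := fun t => t ^ (n + 1) / ((n + 1) * (n + 1).factorial))
      zero_le_one (by fun_prop) (fun t => ?_) fun t ht => div_nonneg (pow_nonneg ht.1 n)
        (by positivity)]
  · simp
  · refine ((hasDerivAt_pow (n + 1) t).div_const
      ((n + 1 : ℝ) * (n + 1).factorial)).congr_deriv ?_
    have hf : ((n + 1).factorial : ℝ) ≠ 0 := by positivity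
    rw [Nat.add_sub_cancel]
    push_cast
    field_simp
end
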